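/- arXiv:1806.01311 — 2 statements merged into one kernel-verified Lean document; each statement's English description precedes it below -/
import Mathlib

section
/- Let N ≥ 5. For every radial function u ∈ D^{2,2}_r(ℝ^N) one has |u(x)| ≤ (2/(N−4)) · (N σ_N)^{−1/2} · ‖Δu‖_{L²} · |x|^{−(N−4)/2} for almost every x ∈ ℝ^N. -/
open MeasureTheory Filter Topology Set ENNReal

noncomputable section

/-- Euclidean space `ℝ^N`. -/
abbrev E (N : ℕ) := EuclideanSpace ℝ (Fin N)

/-- The (classical) Laplacian of a function `φ : ℝ^N → ℝ`. -/
def lapl {N : ℕ} (φ : E N → ℝ) (x : E N) : ℝ :=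
  ∑ i : Fin N, fderiv ℝ (fun y => fderiv ℝ φ y (EuclideanSpace.single i 1)) x
    (EuclideanSpace.single i 1)

/-- A function is radial if it depends only on the norm. -/
def IsRadial {N : ℕ} (u : E N → ℝ) : Prop := ∀ x y : E N, ‖x‖ = ‖y‖ → u x = u y

/-- The critical exponent `2** = 2N/(N-4)` as an element of `ℝ≥0∞`. -/
def twoSS (N : ℕ) : ℝ≥0∞ := (2 * N : ℝ≥0∞) / ((N : ℝ≥0∞) - 4)

/-- `u ∈ D^{2,2}(ℝ^N)` with (distributional) Laplacian `w`: `u` lies in `L^{2**}`,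
`w ∈ L²`, and `u` is the limit in `L^{2**}` of smooth compactly supported functions whose
Laplacians converge to `w` in `L²` (i.e. `u` lies in the closure of `C_c^∞` for the norm
`‖Δ·‖_{L²}`, with `Δu = w`). -/
def MemD22 (N : ℕ) (u w : E N → ℝ) : Prop :=
  MemLp u (twoSS N) volume ∧ MemLp w 2 volume ∧
  ∃ φ : ℕ → E N → ℝ,
    (∀ n, ContDiff ℝ (⊤ : ℕ∞) (φ n) ∧ HasCompactSupport (φ n)) ∧
    Tendsto (fun n => eLpNorm (fun x => φ n x - u x) (twoSS N) volume) atTop (𝓝 0) ∧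
    Tendsto (fun n => eLpNorm (fun x => lapl (φ n) x - w x) 2 volume) atTop (𝓝 0)

/-- `u ∈ H²_V(ℝ^N)` (with Laplacian `w`). -/
def MemH2V {N : ℕ} (V : ℝ → ℝ≥0∞) (u w : E N → ℝ) : Prop :=
  MemD22 N u w ∧ (∫⁻ x : E N, V ‖x‖ * ENNReal.ofReal ((u x) ^ 2)) < ⊤

/-- `u ∈ H²_{V,r}(ℝ^N)`: member of `H²_V` which is radial. -/
def MemH2Vr {N : ℕ} (V : ℝ → ℝ≥0∞) (u w : E N → ℝ) : Prop :=
  MemH2V V u w ∧ IsRadial u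

/-- The norm of `H²_V`: `‖u‖ = (∫ |Δu|² + V(|x|)u²)^{1/2}` (here `w = Δu`). -/
def H2norm {N : ℕ} (V : ℝ → ℝ≥0∞) (u w : E N → ℝ) : ℝ :=
  (((∫⁻ x : E N, ENNReal.ofReal ((w x) ^ 2)) +
    ∫⁻ x : E N, V ‖x‖ * ENNReal.ofReal ((u x) ^ 2)).toReal) ^ (1/2 : ℝ)

/-- Hypothesis (V): `V : (0,∞) → [0,∞]` measurable and locally integrable on `(0,∞)`. -/
def HypV (V : ℝ → ℝ≥0∞) : Prop :=
  Measurable V ∧ ∀ a b : ℝ, 0 < a → (∫⁻ r in Set.Icc a b, V r) < ⊤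

/-- Hypothesis (K): `K : (0,∞) → (0,∞)` measurable with `K ∈ L^s_loc((0,∞))`. -/
def HypK (K : ℝ → ℝ) (s : ℝ) : Prop :=
  (∀ r : ℝ, 0 < r → 0 < K r) ∧ Measurable K ∧ 1 < s ∧
  ∀ a b : ℝ, 0 < a → IntegrableOn (fun r => K r ^ s) (Set.Icc a b) volume

/-- The quantity `S₀(q,R)`. -/
def S0 (N : ℕ) (V : ℝ → ℝ≥0∞) (K : ℝ → ℝ) (q R : ℝ) : ℝ≥0∞ :=
  ⨆ p : {p : (E N → ℝ) × (E N → ℝ) // MemH2Vr V p.1 p.2 ∧ H2norm V p.1 p.2 = 1},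
    ∫⁻ x in Metric.ball (0 : E N) R, ENNReal.ofReal (K ‖x‖ * |p.1.1 x| ^ q)

/-- The quantity `S_∞(q,R)`. -/
def Sinf (N : ℕ) (V : ℝ → ℝ≥0∞) (K : ℝ → ℝ) (q R : ℝ) : ℝ≥0∞ :=
  ⨆ p : {p : (E N → ℝ) × (E N → ℝ) // MemH2Vr V p.1 p.2 ∧ H2norm V p.1 p.2 = 1},
    ∫⁻ x in (Metric.ball (0 : E N) R)ᶜ, ENNReal.ofReal (K ‖x‖ * |p.1.1 x| ^ q)

/-- The quantity `R₀(q,R)`. -/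
def R0 (N : ℕ) (V : ℝ → ℝ≥0∞) (K : ℝ → ℝ) (q R : ℝ) : ℝ≥0∞ :=
  ⨆ p : {p : ((E N → ℝ) × (E N → ℝ)) × ((E N → ℝ) × (E N → ℝ)) //
      MemH2Vr V p.1.1 p.1.2 ∧ MemH2Vr V p.2.1 p.2.2 ∧
      H2norm V p.1.1 p.1.2 = 1 ∧ H2norm V p.2.1 p.2.2 = 1},
    ∫⁻ x in Metric.ball (0 : E N) R,
      ENNReal.ofReal (K ‖x‖ * |p.1.1.1 x| ^ (q - 1) * |p.1.2.1 x|)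

/-- The quantity `R_∞(q,R)`. -/
def Rinf (N : ℕ) (V : ℝ → ℝ≥0∞) (K : ℝ → ℝ) (q R : ℝ) : ℝ≥0∞ :=
  ⨆ p : {p : ((E N → ℝ) × (E N → ℝ)) × ((E N → ℝ) × (E N → ℝ)) //
      MemH2Vr V p.1.1 p.1.2 ∧ MemH2Vr V p.2.1 p.2.2 ∧
      H2norm V p.1.1 p.1.2 = 1 ∧ H2norm V p.2.1 p.2.2 = 1},
    ∫⁻ x in (Metric.ball (0 : E N) R)ᶜ,
      ENNReal.ofReal (K ‖x‖ * |p.1.1.1 x| ^ (q - 1) * |p.1.2.1 x|)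

/-- The weighted measure `K(|x|)dx`. -/
def Kmeas (N : ℕ) (K : ℝ → ℝ) : Measure (E N) :=
  volume.withDensity (fun x => ENNReal.ofReal (K ‖x‖))

/-- Membership in the sum space `L^{q₁}_K + L^{q₂}_K`. -/
def MemSum (N : ℕ) (K : ℝ → ℝ) (q1 q2 : ℝ) (u : E N → ℝ) : Prop :=
  ∃ u1 u2 : E N → ℝ, u = u1 + u2 ∧ MemLp u1 (ENNReal.ofReal q1) (Kmeas N K) ∧
    MemLp u2 (ENNReal.ofReal q2) (Kmeas N K)

/-- The norm of the sum space `L^{q₁}_K + L^{q₂}_K`. -/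
def sumNorm (N : ℕ) (K : ℝ → ℝ) (q1 q2 : ℝ) (u : E N → ℝ) : ℝ≥0∞ :=
  ⨅ p : {p : (E N → ℝ) × (E N → ℝ) // u = p.1 + p.2},
    max (eLpNorm p.1.1 (ENNReal.ofReal q1) (Kmeas N K))
        (eLpNorm p.1.2 (ENNReal.ofReal q2) (Kmeas N K))

/-- `σ_N`, the (N-1)-dimensional measure of the unit sphere, i.e. `N·ω_N`. -/
def sigmaN (N : ℕ) : ℝ := N * (volume (Metric.ball (0 : E N) 1)).toReal

end


lemma ibp1 {N : ℕ} (f g : E N → ℝ) (v : E N) (hf : Differentiable ℝ f)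
    (hf' : Continuous fun x => fderiv ℝ f x v) (hg : ContDiff ℝ 1 g) (hc : HasCompactSupport g) :
    ∫ x, f x * fderiv ℝ g x v = - ∫ x, fderiv ℝ f x v * g x := by
  have hg' : Continuous fun x => fderiv ℝ g x v :=
    (hg.continuous_fderiv (by norm_num)).clm_apply continuous_const
  have hcg' : HasCompactSupport fun x => fderiv ℝ g x v := hc.fderiv_apply (𝕜 := ℝ) v
  apply integral_mul_fderiv_eq_neg_fderiv_mul_of_integrable
  · exact (hf'.mul hg.continuous).integrable_of_hasCompactSupport hc.mul_left
  · exact (hf.continuous.mul hg').integrable_of_hasCompactSupport hcg'.mul_left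
  · exact (hf.continuous.mul hg.continuous).integrable_of_hasCompactSupport hc.mul_left
  · exact fun x _ => hf x
  · exact fun x _ => (hg.differentiable (by norm_num)) x

lemma ibp {N : ℕ} (G V W φ : E N → ℝ) (hφ : ContDiff ℝ (⊤ : ℕ∞) φ) (hc : HasCompactSupport φ)
    (hG : ∀ x, HasFDerivAt G (V x • innerSL ℝ x) x)
    (hV : ∀ x, HasFDerivAt V (W x • innerSL ℝ x) x) (hW : Continuous W) :
    ∫ x, G x * lapl φ x = ∫ x, (W x * ‖x‖ ^ 2 + N * V x) * φ x := by
  have hVd : Differentiable ℝ V := fun x => (hV x).differentiableAt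
  have hGd : Differentiable ℝ G := fun x => (hG x).differentiableAt
  have hp : ∀ v : E N, ContDiff ℝ 1 (fun y => fderiv ℝ φ y v) := fun v => by
    have : ContDiff ℝ 1 (fderiv ℝ φ) := hφ.fderiv_right (m := 1) (by
      norm_cast)
    exact this.clm_apply contDiff_const
  have hpc : ∀ v : E N, HasCompactSupport (fun y => fderiv ℝ φ y v) := fun v =>
    hc.fderiv_apply (𝕜 := ℝ) v
  have hin : ∀ (i : Fin N) (x : E N), (inner ℝ x (EuclideanSpace.single i (1:ℝ))) = x i := by
    intro i x; simp [EuclideanSpace.inner_single_right]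
  have hGf : ∀ (i : Fin N) x, fderiv ℝ G x (EuclideanSpace.single i 1) = V x * x i := by
    intro i x; rw [(hG x).fderiv]; simp [hin]
  have hVx : ∀ (i : Fin N) x, HasFDerivAt (fun y : E N => V y * y i)
      (V x • (EuclideanSpace.proj i : E N →L[ℝ] ℝ) + x i • (W x • innerSL ℝ x)) x := by
    intro i x
    exact (hV x).mul (EuclideanSpace.proj i : E N →L[ℝ] ℝ).hasFDerivAt
  have hVf : ∀ (i : Fin N) x, fderiv ℝ (fun y : E N => V y * y i) x (EuclideanSpace.single i 1)
      = V x + W x * x i ^ 2 := by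
    intro i x; rw [(hVx i x).fderiv]; simp [hin]; ring
  have cx : ∀ i : Fin N, Continuous fun x : E N => x i := fun i =>
    (EuclideanSpace.proj i : E N →L[ℝ] ℝ).continuous
  have key : ∀ i : Fin N, ∫ x, G x * fderiv ℝ (fun y => fderiv ℝ φ y (EuclideanSpace.single i 1)) x
      (EuclideanSpace.single i 1) = ∫ x, (V x + W x * x i ^ 2) * φ x := by
    intro i
    rw [ibp1 G _ _ hGd (by simp_rw [hGf]; exact hVd.continuous.mul (cx i)) (hp _) (hpc _)]
    simp_rw [hGf]
    rw [ibp1 (fun x => V x * x i) φ _ (fun x => (hVx i x).differentiableAt)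
      (by simp_rw [hVf]; exact hVd.continuous.add (hW.mul ((cx i).pow 2)))
      (hφ.of_le (by norm_cast)) hc]
    simp_rw [hVf]; simp
  simp_rw [lapl, Finset.mul_sum]
  rw [integral_finsetSum]
  · simp_rw [key]
    rw [← integral_finsetSum]
    · congr 1; ext x
      rw [← Finset.sum_mul, Finset.sum_add_distrib, ← Finset.mul_sum, EuclideanSpace.real_norm_sq_eq]
      simp; ring_nf; simp
    · intro i _
      exact ((hVd.continuous.add (hW.mul ((cx i).pow 2))).mul hφ.continuous).integrable_of_hasCompactSupport
        hc.mul_left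
  · intro i _
    have h1 := (((hp (EuclideanSpace.single i 1)).continuous_fderiv (by norm_num)).clm_apply 
      (continuous_const (y := (EuclideanSpace.single i (1:ℝ) : E N))))
    exact (hGd.continuous.mul h1).integrable_of_hasCompactSupport
      ((hpc _).fderiv_apply (𝕜 := ℝ) _).mul_left

lemma radial_fderiv {N : ℕ} (f k : ℝ → ℝ) (a : ℝ) (ha : 0 < a)
    (hf : ∀ r, 0 < r → HasDerivAt f (k r * r) r) (c : ℝ) (hfc : ∀ r, r < a → f r = c)
    (hk : k 0 = 0) (x : E N) :
    HasFDerivAt (fun y : E N => f ‖y‖) (k ‖x‖ • innerSL ℝ x) x := by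
  by_cases hx : x = 0
  · subst hx
    have : (fun y : E N => f ‖y‖) =ᶠ[𝓝 0] fun _ => c := by
      filter_upwards [Metric.ball_mem_nhds (0 : E N) ha] with y hy
      exact hfc _ (by simpa using hy)
    refine HasFDerivAt.congr_of_eventuallyEq ?_ this
    simpa [hk] using hasFDerivAt_const c (0 : E N)
  · have hpos : 0 < ‖x‖ := norm_pos_iff.mpr hx
    have h1 : HasFDerivAt (fun y : E N => ‖y‖ ^ 2) (2 • innerSL ℝ x) x :=
      (hasStrictFDerivAt_norm_sq x).hasFDerivAt
    have h2 : HasDerivAt (fun t : ℝ => f (√t)) (k ‖x‖ * ‖x‖ * (1 / (2 * ‖x‖))) (‖x‖ ^ 2) := by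
      have h3 := Real.hasDerivAt_sqrt (x := ‖x‖ ^ 2) (by positivity)
      rw [Real.sqrt_sq hpos.le] at h3
      have h4 := hf ‖x‖ hpos
      rw [← Real.sqrt_sq hpos.le] at h4
      have := h4.comp _ h3
      rw [Real.sqrt_sq hpos.le] at this
      exact this
    have h5 := h2.comp_hasFDerivAt x h1
    refine (h5.congr_of_eventuallyEq ?_).congr_fderiv ?_
    · filter_upwards with y
      simp [Real.sqrt_sq (norm_nonneg y)]
    · ext y; simp; field_simp

lemma cont_aux (f : ℝ → ℝ) (a : ℝ) (ha : 0 < a) (h0 : ∀ r, r ≤ a → f r = 0)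
    (hc : ∀ r, 0 < r → ContinuousAt f r) : Continuous f := by
  rw [continuous_iff_continuousAt]
  intro r
  rcases lt_or_ge 0 r with h | h
  · exact hc r h
  · have : f =ᶠ[𝓝 r] fun _ => 0 := by
      filter_upwards [Iio_mem_nhds (lt_of_le_of_lt h ha)] with y hy
      exact h0 y (le_of_lt hy)
    exact continuousAt_const.congr this.symm

lemma construct (n : ℕ) (a b m : ℝ) (g : ℝ → ℝ) (ha : 0 < a) (hab : a < b) (hg : Continuous g)
    (hg0 : ∀ s, 0 ≤ g s) (hga : ∀ s, s ≤ a → g s = 0) (hgb : ∀ s, b ≤ s → g s = 0)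
    (hm : m = ∫ s in a..b, g s) :
    ∃ Γ V W : ℝ → ℝ, Continuous W ∧ (∀ r, 0 < r → HasDerivAt Γ (V r * r) r) ∧
      (∃ c, ∀ r, r < a → Γ r = c) ∧ (∀ r, r < a → V r = 0) ∧ W 0 = 0 ∧
      (∀ r, 0 < r → HasDerivAt V (W r * r) r) ∧
      (∀ r, 0 ≤ r → W r * r ^ 2 + (n + 5) * V r = - (g r * (r ^ (n + 4))⁻¹)) ∧
      (∀ r, 0 ≤ r → 0 ≤ Γ r ∧ Γ r ≤ m * ((max r a) ^ (n + 3))⁻¹ / (n + 3)) := by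
  have hb : 0 < b := ha.trans hab
  set H : ℝ → ℝ := fun r => ∫ s in a..r, g s with hH
  have gi : ∀ x y, IntervalIntegrable g volume x y := fun x y => hg.intervalIntegrable x y
  have Hd : ∀ r, HasDerivAt H (g r) r := fun r =>
    intervalIntegral.integral_hasDerivAt_right (gi _ _) 
      (hg.stronglyMeasurableAtFilter _ _) hg.continuousAt
  have Hmono : Monotone H := monotone_of_hasDerivAt_nonneg Hd hg0
  have Ha : H a = 0 := by simp [hH]
  have Hb : H b = m := by simp [hH, hm]
  have H0 : ∀ r, r ≤ a → H r = 0 := by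
    intro r hr
    simp only [hH]
    rw [intervalIntegral.integral_congr (g := fun _ => 0)]
    · simp
    · intro s hs
      rw [uIcc_of_ge hr] at hs
      exact hga s hs.2
  have H1 : ∀ r, b ≤ r → H r = m := by
    intro r hr
    have : H r = H b + ∫ s in b..r, g s := by
      simp only [hH]; rw [intervalIntegral.integral_add_adjacent_intervals (gi _ _) (gi _ _)]
    rw [this, Hb, intervalIntegral.integral_congr (g := fun _ => 0)]
    · simp
    · intro s hs
      rw [uIcc_of_le hr] at hs
      exact hgb s hs.1
  have Hle : ∀ r, H r ≤ m := by
    intro r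
    rw [← H1 (max r b) (le_max_right _ _)]
    exact Hmono (le_max_left _ _)
  have Hge : ∀ r, 0 ≤ H r := by
    intro r
    rw [← H0 (min r a) (min_le_right _ _)]
    exact Hmono (min_le_left _ _)
  have Hc : Continuous H := continuous_iff_continuousAt.2 fun r => (Hd r).continuousAt
  set V : ℝ → ℝ := fun r => - (H r) * (r ^ (n + 5))⁻¹ with hV
  set W : ℝ → ℝ := fun r => - (g r) * (r ^ (n + 6))⁻¹ + (n + 5) * H r * (r ^ (n + 7))⁻¹ with hW
  have Vc : Continuous fun r => V r * r := by
    refine cont_aux _ a ha (fun r hr => by simp [hV, H0 r hr]) fun r hr => ?_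
    refine ContinuousAt.mul (ContinuousAt.mul Hc.continuousAt.neg 
      (ContinuousAt.inv₀ (by fun_prop) (by positivity))) continuousAt_id
  have Wc : Continuous W := by
    refine cont_aux _ a ha (fun r hr => by simp [hW, H0 r hr, hga r hr]) fun r hr => ?_
    refine ContinuousAt.add (ContinuousAt.mul hg.continuousAt.neg 
      (ContinuousAt.inv₀ (by fun_prop) (by positivity))) 
      (ContinuousAt.mul (by fun_prop) (ContinuousAt.inv₀ (by fun_prop) (by positivity)))
  have invd : ∀ (k : ℕ) (r : ℝ), 0 < r → HasDerivAt (fun r : ℝ => (r ^ (k + 1))⁻¹)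
      (-(k + 1) * (r ^ (k + 2))⁻¹) r := by
    intro k r hr
    have := (hasDerivAt_pow (k + 1) r).inv (by positivity)
    refine this.congr_deriv ?_
    simp; field_simp; ring
  have Vd : ∀ r, 0 < r → HasDerivAt V (W r * r) r := by
    intro r hr
    refine ((Hd r).neg.mul (invd (n + 4) r hr)).congr_deriv ?_
    simp only [hW]; push_cast; simp only [Pi.neg_apply]; field_simp; ring
  set Γ : ℝ → ℝ := fun r => m * (b ^ (n + 3))⁻¹ / (n + 3) + ∫ s in b..r, V s * s with hΓ
  have Γd : ∀ r, HasDerivAt Γ (V r * r) r := fun r =>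
    (intervalIntegral.integral_hasDerivAt_right (Vc.intervalIntegrable _ _) 
      (Vc.stronglyMeasurableAtFilter _ _) Vc.continuousAt).const_add _
  have Γb : Γ b = m * (b ^ (n + 3))⁻¹ / (n + 3) := by simp [hΓ]
  have Γa : ∀ r, r ≤ a → Γ r = Γ a := by
    intro r hr
    have : Γ r = Γ a + ∫ s in a..r, V s * s := by
      simp only [hΓ]
      rw [add_assoc, intervalIntegral.integral_add_adjacent_intervals 
        (Vc.intervalIntegrable _ _) (Vc.intervalIntegrable _ _)]
    rw [this, intervalIntegral.integral_congr (g := fun _ => 0)]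
    · simp
    · intro s hs
      rw [uIcc_of_ge hr] at hs
      simp [hV, H0 s hs.2]
  set Q : ℝ → ℝ := fun r => m * (r ^ (n + 3))⁻¹ / (n + 3) - Γ r with hQ
  have Qd : ∀ r, 0 < r → HasDerivAt Q ((H r - m) * (r ^ (n + 4))⁻¹) r := by
    intro r hr
    refine ((((invd (n + 2) r hr).const_mul m).div_const _).sub (Γd r)).congr_deriv ?_
    simp only [hV]; push_cast; field_simp; ring
  have Qanti : AntitoneOn Q (Ioi 0) := by
    refine antitoneOn_of_hasDerivWithinAt_nonpos (convex_Ioi 0) 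
      (fun r hr => (Qd r hr).continuousAt.continuousWithinAt) 
      (f' := fun r => (H r - m) * (r ^ (n + 4))⁻¹) ?_ ?_
    · intro r hr
      rw [interior_Ioi] at hr ⊢
      exact (Qd r hr).hasDerivWithinAt
    · intro r hr
      rw [interior_Ioi] at hr
      have hr : 0 < r := hr
      exact mul_nonpos_of_nonpos_of_nonneg (by linarith [Hle r]) (by positivity)
  have Qmono : MonotoneOn Q (Ici b) := by
    refine monotoneOn_of_hasDerivWithinAt_nonneg (convex_Ici b) 
      (fun r hr => (Qd r (hb.trans_le hr)).continuousAt.continuousWithinAt) 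
      (f' := fun r => (H r - m) * (r ^ (n + 4))⁻¹) ?_ ?_
    · intro r hr
      rw [interior_Ici] at hr ⊢
      exact (Qd r (hb.trans hr)).hasDerivWithinAt
    · intro r hr
      rw [interior_Ici] at hr
      have hr : b < r := hr
      rw [H1 r hr.le]; simp
  have Qb : Q b = 0 := by simp [hQ, Γb]
  have Q0 : ∀ r, 0 < r → 0 ≤ Q r := by
    intro r hr
    rcases le_total r b with h | h
    · rw [← Qb]; exact Qanti hr hb h
    · rw [← Qb]; exact Qmono (mem_Ici.2 le_rfl) h h
  have Q1 : ∀ r, b ≤ r → Q r = 0 := by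
    intro r hr
    refine le_antisymm ?_ (Q0 r (hb.trans_le hr))
    rw [← Qb]; exact Qanti hb (hb.trans_le hr) hr
  have m0 : 0 ≤ m := Hb ▸ Hge b
  have Γanti : AntitoneOn Γ (Ici 0) := by
    refine antitoneOn_of_hasDerivWithinAt_nonpos (convex_Ici 0) 
      (fun r hr => (Γd r).continuousAt.continuousWithinAt) 
      (f' := fun r => V r * r) (fun r hr => (Γd r).hasDerivWithinAt) ?_
    intro r hr
    rw [interior_Ici] at hr
    have hr : 0 < r := hr
    simp only [hV]
    have := Hge r
    have : 0 ≤ H r * (r ^ (n + 5))⁻¹ * r := by positivity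
    linarith
  refine ⟨Γ, V, W, Wc, fun r _ => Γd r, ⟨Γ a, fun r hr => Γa r hr.le⟩, 
    fun r hr => by simp [hV, H0 r hr.le], by simp [hW], Vd, ?_, ?_⟩
  · intro r hr
    rcases hr.eq_or_lt with h | h
    · subst h; simp [hV]
    · simp only [hV, hW]; field_simp; ring
  · intro r hr
    constructor
    · have h1 : 0 ≤ Γ (max r b) := by
        have := Q1 (max r b) (le_max_right _ _)
        have h2 : 0 < max r b := lt_max_of_lt_right hb
        have h3 : 0 ≤ m * ((max r b) ^ (n + 3))⁻¹ / (n + 3) := by positivity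
        simp only [hQ] at this
        linarith
      exact h1.trans (Γanti hr (le_max_of_le_left hr : (0:ℝ) ≤ max r b) (le_max_left _ _))
    · have h1 := Q0 (max r a) (lt_max_of_lt_right ha)
      have h2 : Γ r = Γ (max r a) := by
        rcases le_total r a with h | h
        · rw [max_eq_right h, Γa r h]
        · rw [max_eq_left h]
      rw [h2]
      simp only [hQ] at h1
      linarith

lemma holder_abs {N : ℕ} (f g : E N → ℝ) (p q : ℝ≥0∞) [HolderTriple p q 1]
    (hf : MemLp f p volume) (hg : MemLp g q volume) :
    |∫ x, f x * g x| ≤ (eLpNorm f p volume).toReal * (eLpNorm g q volume).toReal := by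
  have h1 : eLpNorm (f • g) 1 volume ≤ eLpNorm f p volume * eLpNorm g q volume :=
    eLpNorm_smul_le_mul_eLpNorm hg.1 hf.1
  have hi : MemLp (f • g) 1 volume := hg.smul hf
  have hi' := memLp_one_iff_integrable.1 hi
  calc |∫ x, f x * g x| ≤ ∫ x, ‖(f • g) x‖ := by
        simpa using norm_integral_le_integral_norm (f • g)
    _ = (eLpNorm (f • g) 1 volume).toReal := by
        rw [eLpNorm_one_eq_lintegral_enorm, integral_norm_eq_lintegral_enorm hi'.1]
    _ ≤ _ := by
        rw [← ENNReal.toReal_mul]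
        exact ENNReal.toReal_mono (ENNReal.mul_ne_top hf.2.ne hg.2.ne) h1

lemma polar (n : ℕ) (f : ℝ → ℝ) :
    ∫ x : E (n + 5), f ‖x‖ = sigmaN (n + 5) * ∫ r in Ioi (0:ℝ), r ^ (n + 4) * f r := by
  have := integral_fun_norm_addHaar (volume : Measure (E (n + 5))) f
  rw [this]
  simp [sigmaN, Measure.real, mul_assoc]

lemma polar_int (n : ℕ) (f : ℝ → ℝ) :
    Integrable (fun x : E (n + 5) => f ‖x‖) ↔ 
    IntegrableOn (fun r => r ^ (n + 4) * f r) (Ioi (0:ℝ)) := by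
  have := integrable_fun_norm_addHaar (volume : Measure (E (n + 5))) (f := f)
  rw [this]
  simp 

lemma bound_int (n : ℕ) (a : ℝ) (ha : 0 < a) :
    IntegrableOn (fun r : ℝ => r ^ (n + 4) * (((max r a) ^ (n + 3))⁻¹) ^ 2) (Ioi 0) ∧
    ∫ r in Ioi (0:ℝ), r ^ (n + 4) * (((max r a) ^ (n + 3))⁻¹) ^ 2 = 
      (a ^ (n + 1))⁻¹ * (1 / (n + 5) + 1 / (n + 1)) := by
  have e1 : ∀ r ∈ Ioc 0 a, r ^ (n + 4) * (((max r a) ^ (n + 3))⁻¹) ^ 2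
      = r ^ (n + 4) * ((a ^ (n + 3))⁻¹) ^ 2 := by
    intro r hr; rw [max_eq_right hr.2]
  have e2 : ∀ r ∈ Ioi a, r ^ (n + 4) * (((max r a) ^ (n + 3))⁻¹) ^ 2
      = r ^ (-((n:ℝ) + 2)) := by
    intro r hr
    have hr' : 0 < r := ha.trans hr
    rw [max_eq_left (le_of_lt hr), Real.rpow_neg hr'.le]
    have : r ^ ((n:ℝ) + 2) = r ^ (n + 2) := by
      rw [← Real.rpow_natCast]; push_cast; rfl
    rw [this]; field_simp; ring
  have i1 : IntegrableOn (fun r : ℝ => r ^ (n + 4) * (((max r a) ^ (n + 3))⁻¹) ^ 2) (Ioc 0 a) := by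
    rw [integrableOn_congr_fun e1 measurableSet_Ioc]
    exact (Continuous.integrableOn_Icc (by fun_prop)).mono_set Ioc_subset_Icc_self
  have i2 : IntegrableOn (fun r : ℝ => r ^ (n + 4) * (((max r a) ^ (n + 3))⁻¹) ^ 2) (Ioi a) := by
    rw [integrableOn_congr_fun e2 measurableSet_Ioi]
    exact integrableOn_Ioi_rpow_of_lt (by have : (0:ℝ) ≤ n := n.cast_nonneg; linarith) ha
  have un : Ioi (0:ℝ) = Ioc 0 a ∪ Ioi a := (Ioc_union_Ioi_eq_Ioi ha.le).symm
  refine ⟨un ▸ i1.union i2, ?_⟩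
  rw [un, setIntegral_union (by rw [disjoint_left]; intro r h1 h2; exact absurd h1.2 (not_le.2 h2)) 
    measurableSet_Ioi i1 i2,
    setIntegral_congr_fun measurableSet_Ioc e1, setIntegral_congr_fun measurableSet_Ioi e2,
    integral_Ioi_rpow_of_lt (by have : (0:ℝ) ≤ n := n.cast_nonneg; linarith) ha,
    ← intervalIntegral.integral_of_le ha.le]
  rw [intervalIntegral.integral_mul_const, integral_pow]
  have : a ^ (-((n:ℝ) + 2) + 1) = (a ^ (n + 1))⁻¹ := by
    rw [← Real.rpow_natCast, ← Real.rpow_neg ha.le]; push_cast; ring_nf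
  rw [this]
  have h : -((n:ℝ) + 2) + 1 = -(n + 1) := by ring
  rw [h]
  push_cast
  have : (n:ℝ) + 4 + 1 = n + 5 := by ring
  rw [this]
  field_simp
  simp; ring

lemma sigma_pos (n : ℕ) : 0 < sigmaN (n + 5) := by
  have : 0 < (volume (Metric.ball (0 : E (n + 5)) 1)).toReal :=
    ENNReal.toReal_pos (Metric.measure_ball_pos _ _ one_pos).ne' measure_ball_lt_top.ne
  unfold sigmaN
  positivity

lemma lapl_cont {N : ℕ} (φ : E N → ℝ) (hφ : ContDiff ℝ (⊤ : ℕ∞) φ) (hc : HasCompactSupport φ) :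
    Continuous (lapl φ) ∧ HasCompactSupport (lapl φ) := by
  have hp : ∀ v : E N, ContDiff ℝ 1 (fun y => fderiv ℝ φ y v) := fun v => by
    have : ContDiff ℝ 1 (fderiv ℝ φ) := hφ.fderiv_right (m := 1) (by
      norm_cast)
    exact this.clm_apply contDiff_const
  have hpc : ∀ v : E N, HasCompactSupport (fun y => fderiv ℝ φ y v) := fun v =>
    hc.fderiv_apply (𝕜 := ℝ) v
  constructor
  · unfold lapl
    refine continuous_finsetSum _ fun i _ => ?_
    exact (((hp (EuclideanSpace.single i 1)).continuous_fderiv (by norm_num)).clm_apply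
      (continuous_const (y := (EuclideanSpace.single i (1:ℝ) : E N))))
  · refine HasCompactSupport.intro hc.isCompact fun x hx => ?_
    unfold lapl
    refine Finset.sum_eq_zero fun i _ => ?_
    have h0 : φ =ᶠ[𝓝 x] 0 := notMem_tsupport_iff_eventuallyEq.1 hx
    have h1 : (fun y => fderiv ℝ φ y (EuclideanSpace.single i (1:ℝ))) =ᶠ[𝓝 x] fun _ => 0 := by
      filter_upwards [h0.eventuallyEq_nhds] with y hy
      rw [hy.fderiv_eq]; simp
    rw [h1.fderiv_eq]; simp

lemma testbound (n : ℕ) (a b m : ℝ) (g : ℝ → ℝ) (ha : 0 < a) (hab : a < b) (hg : Continuous g)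
    (hg0 : ∀ s, 0 ≤ g s) (hga : ∀ s, s ≤ a → g s = 0) (hgb : ∀ s, b ≤ s → g s = 0)
    (hm : m = ∫ s in a..b, g s) (φ : E (n + 5) → ℝ)
    (hφ : ContDiff ℝ (⊤ : ℕ∞) φ) (hc : HasCompactSupport φ) :
    |∫ x, φ x * (g ‖x‖ * (‖x‖ ^ (n + 4))⁻¹)| ≤
      √(sigmaN (n + 5) * m ^ 2 * (a ^ (n + 1))⁻¹ * (2 / ((n + 5) * (n + 1) * (n + 3)))) *
        (eLpNorm (lapl φ) 2 volume).toReal := by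
  obtain ⟨Γ, V, W, hW, hΓ, ⟨c, hΓc⟩, hV0, hW0, hV, heq, hΓb⟩ :=
    construct n a b m g ha hab hg hg0 hga hgb hm
  have dG : ∀ x : E (n + 5), HasFDerivAt (fun y : E (n + 5) => Γ ‖y‖) (V ‖x‖ • innerSL ℝ x) x :=
    radial_fderiv Γ V a ha hΓ c hΓc (hV0 0 ha)
  have dV : ∀ x : E (n + 5), HasFDerivAt (fun y : E (n + 5) => V ‖y‖) (W ‖x‖ • innerSL ℝ x) x :=
    radial_fderiv V W a ha hV 0 hV0 hW0
  have key := ibp (fun x => Γ ‖x‖) (fun x => V ‖x‖) (fun x => W ‖x‖) φ hφ hc dG dV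
    (hW.comp continuous_norm)
  have key2 : ∫ x, φ x * (g ‖x‖ * (‖x‖ ^ (n + 4))⁻¹) = - ∫ x, Γ ‖x‖ * lapl φ x := by
    rw [key, ← integral_neg]
    congr 1; ext x
    have := heq ‖x‖ (norm_nonneg x)
    push_cast
    rw [this]; ring
  have Gc : Continuous fun x : E (n + 5) => Γ ‖x‖ :=
    continuous_iff_continuousAt.2 fun x => (dG x).continuousAt
  obtain ⟨bi, be⟩ := bound_int n a ha
  have Bi : Integrable fun x : E (n + 5) => (m / (n + 3)) ^ 2 * (((max ‖x‖ a) ^ (n + 3))⁻¹) ^ 2 :=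
    ((polar_int n (fun r => (((max r a) ^ (n + 3))⁻¹) ^ 2)).2 bi).const_mul _
  have Be : ∫ x : E (n + 5), (m / (n + 3)) ^ 2 * (((max ‖x‖ a) ^ (n + 3))⁻¹) ^ 2 =
      sigmaN (n + 5) * m ^ 2 * (a ^ (n + 1))⁻¹ * (2 / ((n + 5) * (n + 1) * (n + 3))) := by
    rw [integral_const_mul, polar n (fun r => (((max r a) ^ (n + 3))⁻¹) ^ 2), be]
    field_simp; ring
  have hle : ∀ x : E (n + 5), (Γ ‖x‖) ^ 2 ≤ (m / (n + 3)) ^ 2 * (((max ‖x‖ a) ^ (n + 3))⁻¹) ^ 2 := by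
    intro x
    obtain ⟨h1, h2⟩ := hΓb ‖x‖ (norm_nonneg x)
    calc (Γ ‖x‖) ^ 2 ≤ (m * ((max ‖x‖ a) ^ (n + 3))⁻¹ / (n + 3)) ^ 2 := pow_le_pow_left₀ h1 h2 2
      _ = _ := by ring
  have Gi : Integrable fun x : E (n + 5) => (Γ ‖x‖) ^ 2 := by
    refine Bi.mono' (Gc.pow 2).aestronglyMeasurable (Eventually.of_forall fun x => ?_)
    rw [Real.norm_of_nonneg (sq_nonneg _)]
    exact hle x
  have hGL : MemLp (fun x : E (n + 5) => Γ ‖x‖) 2 volume :=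
    (memLp_two_iff_integrable_sq Gc.aestronglyMeasurable).2 Gi
  have Gn : (eLpNorm (fun x : E (n + 5) => Γ ‖x‖) 2 volume).toReal ≤
      √(sigmaN (n + 5) * m ^ 2 * (a ^ (n + 1))⁻¹ * (2 / ((n + 5) * (n + 1) * (n + 3)))) := by
    rw [hGL.eLpNorm_eq_integral_rpow_norm (by norm_num) (by norm_num),
      ENNReal.toReal_ofReal (by positivity), ← Be, Real.sqrt_eq_rpow]
    simp only [ENNReal.toReal_ofNat, Real.rpow_two, Real.norm_eq_abs, sq_abs]
    rw [← one_div]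
    exact Real.rpow_le_rpow (integral_nonneg fun x => sq_nonneg _) (integral_mono Gi Bi hle)
      (by norm_num)
  obtain ⟨lc, ls⟩ := lapl_cont φ hφ hc
  rw [key2, abs_neg]
  refine (holder_abs (fun x => Γ ‖x‖) (lapl φ) 2 2 hGL (lc.memLp_of_hasCompactSupport ls)).trans ?_
  gcongr

lemma twoSS_ge (n : ℕ) : 1 ≤ twoSS (n + 5) := by
  unfold twoSS
  have h : (((n + 5 : ℕ) : ℝ≥0∞) - 4) = ((n + 1 : ℕ) : ℝ≥0∞) := by
    have : ((n + 5 : ℕ) : ℝ≥0∞) = ((n + 1 : ℕ) : ℝ≥0∞) + 4 := by push_cast; ring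
    rw [this, ENNReal.add_sub_cancel_right (by norm_num)]
  rw [h, ENNReal.le_div_iff_mul_le (Or.inl (by simp)) (Or.inl (by simp))]
  norm_cast
  omega

lemma limbound (n : ℕ) (a b m : ℝ) (g : ℝ → ℝ) (ha : 0 < a) (hab : a < b) (hg : Continuous g)
    (hg0 : ∀ s, 0 ≤ g s) (hga : ∀ s, s ≤ a → g s = 0) (hgb : ∀ s, b ≤ s → g s = 0)
    (hm : m = ∫ s in a..b, g s) (u w : E (n + 5) → ℝ) (hu : MemD22 (n + 5) u w) :
    |∫ x, u x * (g ‖x‖ * (‖x‖ ^ (n + 4))⁻¹)| ≤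
      √(sigmaN (n + 5) * m ^ 2 * (a ^ (n + 1))⁻¹ * (2 / ((n + 5) * (n + 1) * (n + 3)))) *
        (eLpNorm w 2 volume).toReal := by
  obtain ⟨hu, hw, φ, hφ, h1, h2⟩ := hu
  set K := √(sigmaN (n + 5) * m ^ 2 * (a ^ (n + 1))⁻¹ * (2 / ((n + 5) * (n + 1) * (n + 3))))
  set ψ : E (n + 5) → ℝ := fun x => g ‖x‖ * (‖x‖ ^ (n + 4))⁻¹ with hψ
  have ψc : Continuous ψ := by
    have : Continuous fun r : ℝ => g r * (r ^ (n + 4))⁻¹ :=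
      cont_aux _ a ha (fun r hr => by simp [hga r hr]) fun r hr =>
        hg.continuousAt.mul (ContinuousAt.inv₀ (by fun_prop) (by positivity))
    exact this.comp continuous_norm
  have ψs : HasCompactSupport ψ := by
    refine HasCompactSupport.intro (isCompact_closedBall (0 : E (n + 5)) b) fun x hx => ?_
    have : b < ‖x‖ := by simpa using hx
    simp [hψ, hgb _ this.le]
  set p := twoSS (n + 5)
  have hp1 : 1 ≤ p := twoSS_ge n
  obtain ⟨q, hq⟩ : ∃ q : ℝ≥0∞, p.HolderConjugate q := ⟨_, .conjExponent hp1⟩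
  have ψq : MemLp ψ q volume := ψc.memLp_of_hasCompactSupport ψs
  have φp : ∀ k, MemLp (φ k) p volume := fun k =>
    (hφ k).1.continuous.memLp_of_hasCompactSupport (hφ k).2
  have lL : ∀ k, MemLp (lapl (φ k)) 2 volume := fun k =>
    (lapl_cont _ (hφ k).1 (hφ k).2).1.memLp_of_hasCompactSupport
      (lapl_cont _ (hφ k).1 (hφ k).2).2
  have t1 : Tendsto (fun k => (eLpNorm (fun x => φ k x - u x) p volume).toReal) atTop (𝓝 0) := by
    simpa [Function.comp_def] using (ENNReal.tendsto_toReal zero_ne_top).comp h1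
  have t2 : Tendsto (fun k => (eLpNorm (fun x => lapl (φ k) x - w x) 2 volume).toReal)
      atTop (𝓝 0) := by
    simpa [Function.comp_def] using (ENNReal.tendsto_toReal zero_ne_top).comp h2
  have b2 : ∀ k, (eLpNorm (lapl (φ k)) 2 volume).toReal ≤
      (eLpNorm (fun x => lapl (φ k) x - w x) 2 volume).toReal + (eLpNorm w 2 volume).toReal := by
    intro k
    have hd : MemLp (fun x => lapl (φ k) x - w x) 2 volume := (lL k).sub hw
    have := eLpNorm_add_le (p := 2) hd.1 hw.1 (by norm_num)
    have e : ((fun x => lapl (φ k) x - w x) + w) = lapl (φ k) := by ext x; simp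
    rw [e] at this
    rw [← ENNReal.toReal_add hd.2.ne hw.2.ne]
    exact ENNReal.toReal_mono (ENNReal.add_ne_top.2 ⟨hd.2.ne, hw.2.ne⟩) this
  have int : ∀ f : E (n + 5) → ℝ, MemLp f p volume → Integrable fun x => f x * ψ x := fun f hf =>
    memLp_one_iff_integrable.1 (ψq.smul hf)
  have b1 : ∀ k, |∫ x, u x * ψ x| ≤
      (eLpNorm (fun x => φ k x - u x) p volume).toReal * (eLpNorm ψ q volume).toReal +
      K * ((eLpNorm (fun x => lapl (φ k) x - w x) 2 volume).toReal +
        (eLpNorm w 2 volume).toReal) := by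
    intro k
    have hd : MemLp (fun x => φ k x - u x) p volume := (φp k).sub hu
    have e : ∫ x, u x * ψ x = (∫ x, φ k x * ψ x) - ∫ x, (φ k x - u x) * ψ x := by
      rw [← integral_sub (int _ (φp k)) (int _ hd)]
      congr 1; ext x; ring
    have a1 := holder_abs _ ψ p q hd ψq
    have a2 := testbound n a b m g ha hab hg hg0 hga hgb hm (φ k) (hφ k).1 (hφ k).2
    have a3 : K * (eLpNorm (lapl (φ k)) 2 volume).toReal ≤ K * _ :=
      mul_le_mul_of_nonneg_left (b2 k) (Real.sqrt_nonneg _)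
    rw [e]
    refine (abs_sub _ _).trans ?_
    linarith
  have lim := (t1.mul_const (eLpNorm ψ q volume).toReal).add
    ((t2.add_const (eLpNorm w 2 volume).toReal).const_mul K)
  simp only [zero_mul, zero_add] at lim
  exact ge_of_tendsto' lim b1

lemma ae_norm (n : ℕ) (P : ℝ → Prop) (hP : ∀ᵐ r : ℝ, P r) : ∀ᵐ x : E (n + 5), P ‖x‖ := by
  obtain ⟨S, hS, hm, h0⟩ := exists_measurable_superset_of_null hP
  set f : ℝ → ℝ := S.indicator fun _ => 1
  have fz : f =ᵐ[volume] 0 := indicator_meas_zero h0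
  have fz' : (fun r => r ^ (n + 4) * f r) =ᵐ[volume.restrict (Ioi 0)] 0 := by
    filter_upwards [ae_restrict_of_ae fz] with r hr
    simp [hr]
  have hi : Integrable fun x : E (n + 5) => f ‖x‖ :=
    (polar_int n f).2 ((integrable_zero _ _ _).congr fz'.symm)
  have hz : ∫ x : E (n + 5), f ‖x‖ = 0 := by
    rw [polar, integral_congr_ae fz']; simp
  have := (integral_eq_zero_iff_of_nonneg
    (fun x : E (n + 5) => indicator_nonneg (fun _ _ => zero_le_one) ‖x‖) hi).1 hz
  filter_upwards [this] with x hx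
  by_contra hn
  have : ‖x‖ ∈ S := hS hn
  simp [this] at hx

lemma loc_int (n : ℕ) (u : E (n + 5) → ℝ) (U : ℝ → ℝ) (hU : ∀ x, u x = U ‖x‖)
    (hu : LocallyIntegrable u volume) :
    LocallyIntegrable ((Ioi (0:ℝ)).indicator fun r => r ^ (n + 4) * U r) volume := by
  rw [locallyIntegrable_iff]
  intro k hk
  obtain ⟨R, hR⟩ := hk.isBounded.subset_ball (0:ℝ)
  have h1 : IntegrableOn (fun x : E (n + 5) => U ‖x‖) (Metric.ball 0 R) volume := by
    have : (fun x : E (n + 5) => U ‖x‖) = u := by ext x; exact (hU x).symm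
    rw [this]
    exact (hu.integrableOn_isCompact (isCompact_closedBall 0 R)).mono_set Metric.ball_subset_closedBall
  have h2 := (integrableOn_fun_norm_addHaar (volume : Measure (E (n + 5))) (f := U)).1 h1
  simp only [finrank_euclideanSpace, Fintype.card_fin, smul_eq_mul] at h2
  have h3 : IntegrableOn (fun r : ℝ => r ^ (n + 4) * U r) (Ioo 0 R) := h2
  rw [← integrable_indicator_iff measurableSet_Ioo] at h3
  refine IntegrableOn.congr_fun_ae (h3.integrableOn (s := k)) ?_
  refine (ae_restrict_iff' hk.measurableSet).2 (Eventually.of_forall fun r hr => ?_)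
  have hr' : r < R := by
    have := hR hr
    simp at this
    exact (le_abs_self r).trans_lt this
  by_cases h0 : 0 < r
  · simp [indicator, h0, hr']
  · simp [indicator, h0]

lemma step (n : ℕ) (u w : E (n + 5) → ℝ) (hu : MemD22 (n + 5) u w) (U : ℝ → ℝ)
    (hU : ∀ x, u x = U ‖x‖) (B : ContDiffBump (0:ℝ)) (r₀ : ℝ) (hr : B.rOut < r₀) :
    sigmaN (n + 5) * |(convolution (B.normed volume)
      ((Ioi (0:ℝ)).indicator fun r => r ^ (n + 4) * U r)
      (ContinuousLinearMap.lsmul ℝ ℝ) volume) r₀| ≤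
      √(sigmaN (n + 5) * ((r₀ + B.rOut) ^ (n + 4)) ^ 2 * ((r₀ - B.rOut) ^ (n + 1))⁻¹ *
        (2 / ((n + 5) * (n + 1) * (n + 3)))) * (eLpNorm w 2 volume).toReal := by
  have hρ := B.rOut_pos
  set ρ := B.rOut with hρd
  set k : ℝ → ℝ := fun s => B.normed volume (r₀ - s) with hk
  have kc : Continuous k := B.continuous_normed.comp (by fun_prop)
  have k0 : ∀ s, 0 ≤ k s := fun s => B.nonneg_normed _
  have kz : ∀ s, ρ ≤ |r₀ - s| → k s = 0 := by
    intro s hs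
    have : (r₀ - s) ∉ Function.support (B.normed volume) := by
      rw [B.support_normed_eq]; simpa using hs
    simpa using this
  have ki : Integrable k := B.integrable_normed.comp_sub_left r₀
  have k1 : ∫ s, k s = 1 := by
    rw [hk, integral_sub_left_eq_self (fun s => B.normed volume s) volume r₀, B.integral_normed]
  set g : ℝ → ℝ := fun s => k s * s ^ (n + 4) with hg
  have ka : ∀ s, s ≤ r₀ - ρ → k s = 0 := fun s hs =>
    kz s (by rw [le_abs]; left; linarith)
  have kb : ∀ s, r₀ + ρ ≤ s → k s = 0 := fun s hs =>
    kz s (by rw [le_abs]; right; linarith)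
  have gc : Continuous g := kc.mul (by fun_prop)
  have g0 : ∀ s, 0 ≤ g s := by
    intro s
    rcases le_or_gt s (r₀ - ρ) with h | h
    · simp [hg, ka s h]
    · have : 0 < s := by linarith
      have := k0 s
      positivity
  have hle : r₀ - ρ < r₀ + ρ := by linarith
  have main := limbound n (r₀ - ρ) (r₀ + ρ) _ g (by linarith) hle gc g0
    (fun s hs => by simp [hg, ka s hs]) (fun s hs => by simp [hg, kb s hs]) rfl u w hu
  have m0 : 0 ≤ ∫ s in (r₀ - ρ)..(r₀ + ρ), g s :=
    intervalIntegral.integral_nonneg hle.le fun s _ => g0 s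
  have m1 : ∫ s in (r₀ - ρ)..(r₀ + ρ), g s ≤ (r₀ + ρ) ^ (n + 4) := by
    calc ∫ s in (r₀ - ρ)..(r₀ + ρ), g s ≤ ∫ s in (r₀ - ρ)..(r₀ + ρ), k s * (r₀ + ρ) ^ (n + 4) := by
          refine intervalIntegral.integral_mono_on hle.le (gc.intervalIntegrable _ _)
            ((kc.mul continuous_const).intervalIntegrable _ _) fun s hs => ?_
          have : 0 ≤ s := by linarith [hs.1]
          exact mul_le_mul_of_nonneg_left (pow_le_pow_left₀ this hs.2 _) (k0 s)
      _ = (∫ s in Ioc (r₀ - ρ) (r₀ + ρ), k s) * (r₀ + ρ) ^ (n + 4) := by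
          rw [intervalIntegral.integral_mul_const, intervalIntegral.integral_of_le hle.le]
      _ ≤ 1 * (r₀ + ρ) ^ (n + 4) := by
          refine mul_le_mul_of_nonneg_right ?_ (by have : 0 < r₀ + ρ := by linarith
                                                   positivity)
          rw [← k1]
          exact setIntegral_le_integral ki (Eventually.of_forall k0)
      _ = _ := one_mul _
  have e1 : ∫ x, u x * (g ‖x‖ * (‖x‖ ^ (n + 4))⁻¹) = sigmaN (n + 5) *
      (convolution (B.normed volume)
      ((Ioi (0:ℝ)).indicator fun r => r ^ (n + 4) * U r)
      (ContinuousLinearMap.lsmul ℝ ℝ) volume) r₀ := by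
    simp_rw [hU]
    rw [polar n (fun r => U r * (g r * (r ^ (n + 4))⁻¹)), convolution_eq_swap]
    congr 1
    rw [← integral_indicator measurableSet_Ioi]
    congr 1; ext s
    by_cases hs : 0 < s
    · simp only [indicator, mem_Ioi, hs, if_true, ContinuousLinearMap.lsmul_apply, smul_eq_mul, hg, hk]
      field_simp
    · simp [indicator, hs]
  rw [e1, abs_mul, abs_of_pos (sigma_pos n)] at main
  refine main.trans ?_
  have := sigma_pos n
  have : 0 < r₀ - ρ := by linarith
  gcongr

lemma final_arith (n : ℕ) (σ r A c : ℝ) (hσ : 0 < σ) (hr : 0 < r) (hc : 0 ≤ c)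
    (h : σ * |r ^ (n + 4) * A| ≤ √(σ * (r ^ (n + 4)) ^ 2 * (r ^ (n + 1))⁻¹ *
        (2 / ((n + 5) * (n + 1) * (n + 3)))) * c) :
    |A| ≤ 2 / (((n + 5 : ℕ) : ℝ) - 4) * (1 / √((n + 5 : ℕ) * σ)) * c / 
      r ^ ((((n + 5 : ℕ) : ℝ) - 4) / 2) := by
  have e0 : (((n + 5 : ℕ) : ℝ) - 4) = n + 1 := by push_cast; ring
  rw [e0]
  have e1 : r ^ (((n:ℝ) + 1) / 2) = √(r ^ (n + 1)) := by
    rw [Real.sqrt_eq_rpow, ← Real.rpow_natCast, ← Real.rpow_mul hr.le]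
    push_cast; ring_nf
  rw [e1]
  have key : √(σ * (r ^ (n + 4)) ^ 2 * (r ^ (n + 1))⁻¹ * (2 / ((n + 5) * (n + 1) * (n + 3)))) ≤
      σ * r ^ (n + 4) * (2 / (n + 1) * (1 / √((n + 5 : ℕ) * σ)) / √(r ^ (n + 1))) := by
    rw [Real.sqrt_le_left (by positivity)]
    have s1 : √((n + 5 : ℕ) * σ) ^ 2 = (n + 5) * σ := by
      rw [Real.sq_sqrt (by positivity)]; push_cast; ring
    have s2 : √(r ^ (n + 1)) ^ 2 = r ^ (n + 1) := Real.sq_sqrt (by positivity)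
    simp only [mul_pow, div_pow, s1, s2, one_pow]
    have : (2:ℝ) / ((n + 5) * (n + 1) * (n + 3)) ≤ 2 ^ 2 / ((n + 1) ^ 2 * (n + 5)) := by
      rw [div_le_div_iff₀ (by positivity) (by positivity)]
      have : (0:ℝ) ≤ (n + 5) * (n + 1) * (2 * n + 10) := by positivity
      nlinarith
    calc _ ≤ σ * (r ^ (n + 4)) ^ 2 * (r ^ (n + 1))⁻¹ * (2 ^ 2 / ((n + 1) ^ 2 * (n + 5))) := by
          gcongr
      _ = _ := by field_simp
  rw [abs_mul, abs_of_pos (by positivity : 0 < r ^ (n + 4))] at h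
  have h2 := h.trans (mul_le_mul_of_nonneg_right key hc)
  have hp : 0 < σ * r ^ (n + 4) := by positivity
  refine le_of_mul_le_mul_left ?_ hp
  calc σ * r ^ (n + 4) * |A| = σ * (r ^ (n + 4) * |A|) := by ring
    _ ≤ _ := h2
    _ = _ := by ring

/-- Lemma `stimepunt`, estimate (1.1): for `N ≥ 5` and every radial
`u ∈ D^{2,2}_r(ℝ^N)` with Laplacian `w`, one has
`|u(x)| ≤ (2/(N-4)) (N σ_N)^{-1/2} ‖Δu‖_{L²} |x|^{-(N-4)/2}` a.e. in `ℝ^N`. -/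
theorem stmt0 (N : ℕ) (hN : 5 ≤ N) (u w : E N → ℝ)
    (hu : MemD22 N u w) (hrad : IsRadial u) :
    ∀ᵐ x : E N ∂volume,
      |u x| ≤ (2 / ((N : ℝ) - 4)) * (1 / Real.sqrt (N * sigmaN N)) *
        (eLpNorm w 2 volume).toReal / ‖x‖ ^ (((N : ℝ) - 4) / 2) := by
  obtain ⟨n, rfl⟩ : ∃ n, N = n + 5 := ⟨N - 5, by omega⟩
  set U : ℝ → ℝ := fun r => u (EuclideanSpace.single 0 r) with hUd
  have hU : ∀ x, u x = U ‖x‖ := by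
    intro x
    apply hrad
    simp
  have hloc : LocallyIntegrable u volume := hu.1.locallyIntegrable (twoSS_ge n)
  have hf := loc_int n u U hU hloc
  set B : ℕ → ContDiffBump (0:ℝ) := fun i =>
    { rIn := 1 / ((i:ℝ) + 1) / 2
      rOut := 1 / ((i:ℝ) + 1)
      rIn_pos := by positivity
      rIn_lt_rOut := half_lt_self (by positivity) } with hB
  have hB0 : Tendsto (fun i => (B i).rOut) atTop (𝓝 0) := tendsto_one_div_add_atTop_nhds_zero_nat
  have hae := ContDiffBump.ae_convolution_tendsto_right_of_locallyIntegrable (μ := volume) (K := 2)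
    hB0 (Eventually.of_forall fun i => by simp only [hB]; linarith) hf
  have hae2 : ∀ᵐ r : ℝ, 0 < r → |U r| ≤ 2 / (((n + 5 : ℕ) : ℝ) - 4) *
      (1 / √((n + 5 : ℕ) * sigmaN (n + 5))) * (eLpNorm w 2 volume).toReal /
      r ^ ((((n + 5 : ℕ) : ℝ) - 4) / 2) := by
    filter_upwards [hae] with r hr hr0
    apply final_arith n _ r _ _ (sigma_pos n) hr0 ENNReal.toReal_nonneg
    have l1 := (hr.abs).const_mul (sigmaN (n + 5))
    have l2 : Tendsto (fun i => √(sigmaN (n + 5) * ((r + (B i).rOut) ^ (n + 4)) ^ 2 *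
        ((r - (B i).rOut) ^ (n + 1))⁻¹ * (2 / ((n + 5) * (n + 1) * (n + 3)))) *
        (eLpNorm w 2 volume).toReal) atTop (𝓝 (√(sigmaN (n + 5) * ((r + 0) ^ (n + 4)) ^ 2 *
        ((r - 0) ^ (n + 1))⁻¹ * (2 / ((n + 5) * (n + 1) * (n + 3)))) *
        (eLpNorm w 2 volume).toReal)) := by
      refine Tendsto.mul_const _ (Tendsto.sqrt (Tendsto.mul_const _ (Tendsto.mul
        (Tendsto.const_mul _ (((hB0.const_add r).pow _).pow _))
        (Tendsto.inv₀ ((hB0.const_sub r).pow _) ?_))))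
      rw [sub_zero]; positivity
    rw [add_zero, sub_zero] at l2
    rw [indicator_of_mem (mem_Ioi.2 hr0)] at l1
    refine le_of_tendsto_of_tendsto l1 l2 ?_
    filter_upwards [hB0.eventually_lt_const hr0] with i hi
    exact step n u w hu U hU (B i) r hi
  filter_upwards [ae_norm n _ hae2, Measure.ae_ne volume (0 : E (n + 5))] with x hx hx0
  rw [hU x]
  exact hx (norm_pos_iff.2 hx0)
end

section
/- Assume hypotheses (V) and (K). Suppose there exists R₂ > 0 such that V(r) < +∞ for almost every r > R₂ and ess sup_{r>R₂} K(r)/(r^{α_∞} V(r)^{β_∞}) < +∞ for some 0 ≤ β_∞ ≤ 1 and α_∞ ∈ ℝ. Then lim_{R→+∞} R_∞(q₂,R) = 0 for every q₂ ∈ ℝ with q₂ > max{1, 2β_∞, q*(α_∞,β_∞)}. -/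
open MeasureTheory Filter Topology Set ENNReal

noncomputable section

/-- `q*(α,β) = 2(α-4β+N)/(N-4)`. -/
def qStar (N : ℕ) (α β : ℝ) : ℝ := 2 * (α - 4*β + N) / (N - 4)


lemma aux_ibp {N : ℕ} (φ ψ : E N → ℝ) (hφ : ContDiff ℝ (⊤ : ℕ∞) φ) (hφc : HasCompactSupport φ)
    (hψ : Differentiable ℝ ψ) (G D : Fin N → E N → ℝ) (hG : ∀ i, Differentiable ℝ (G i))
    (hDc : ∀ i, Continuous (D i))
    (h1 : ∀ i x, fderiv ℝ ψ x (EuclideanSpace.single i 1) = G i x)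
    (h2 : ∀ i x, fderiv ℝ (G i) x (EuclideanSpace.single i 1) = D i x) :
    ∫ x, lapl φ x * ψ x = ∫ x, φ x * ∑ i, D i x := by
  have hd : ∀ i : Fin N, ContDiff ℝ (⊤ : ℕ∞)
      (fun y => fderiv ℝ φ y (EuclideanSpace.single i 1)) := by
    intro i
    exact (hφ.fderiv_right (m := (⊤ : ℕ∞)) (by simp)).clm_apply contDiff_const
  have hdc : ∀ i : Fin N, HasCompactSupport
      (fun y => fderiv ℝ φ y (EuclideanSpace.single i 1)) :=
    fun i => hφc.fderiv_apply ℝ _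
  have hdd : ∀ i : Fin N, Continuous
      (fun y => fderiv ℝ (fun y => fderiv ℝ φ y (EuclideanSpace.single i 1)) y
        (EuclideanSpace.single i 1)) := by
    intro i
    exact (((hd i).fderiv_right (m := (⊤ : ℕ∞)) (by simp)).clm_apply contDiff_const).continuous
  have hddc : ∀ i : Fin N, HasCompactSupport
      (fun y => fderiv ℝ (fun y => fderiv ℝ φ y (EuclideanSpace.single i 1)) y
        (EuclideanSpace.single i 1)) :=
    fun i => (hdc i).fderiv_apply ℝ _
  have I : ∀ f g : E N → ℝ, Continuous f → HasCompactSupport f → Continuous g →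
      Integrable (fun x => f x * g x) := by
    intro f g hf hfc hg
    exact (hf.mul hg).integrable_of_hasCompactSupport hfc.mul_right
  have key : ∀ i : Fin N, ∫ x, fderiv ℝ (fun y => fderiv ℝ φ y (EuclideanSpace.single i 1)) x
      (EuclideanSpace.single i 1) * ψ x = ∫ x, φ x * D i x := by
    intro i
    have e1 := integral_mul_fderiv_eq_neg_fderiv_mul_of_integrable (μ := (volume : Measure (E N)))
      (f := fun y => fderiv ℝ φ y (EuclideanSpace.single i 1)) (g := ψ)
      (v := EuclideanSpace.single i 1)
      (I _ _ (hdd i) (hddc i) hψ.continuous)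
      (by simp_rw [h1]; exact I _ _ (hd i).continuous (hdc i) (hG i).continuous)
      (I _ _ (hd i).continuous (hdc i) hψ.continuous)
      (fun x _ => ((hd i).differentiable (by simp)) x) (fun x _ => hψ x)
    have e2 := integral_mul_fderiv_eq_neg_fderiv_mul_of_integrable (μ := (volume : Measure (E N)))
      (f := φ) (g := G i) (v := EuclideanSpace.single i 1)
      (I _ _ (hd i).continuous (hdc i) (hG i).continuous)
      (by simp_rw [h2]; exact I _ _ hφ.continuous hφc (hDc i))
      (I _ _ hφ.continuous hφc (hG i).continuous)
      (fun x _ => (hφ.differentiable (by simp)) x) (fun x _ => hG i x)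
    simp_rw [h1] at e1
    simp_rw [h2] at e2
    rw [e2, e1, neg_neg]
  unfold lapl
  simp_rw [Finset.sum_mul, Finset.mul_sum]
  rw [integral_finsetSum _ (fun i _ => I _ _ (hdd i) (hddc i) hψ.continuous),
    integral_finsetSum _ (fun i _ => I _ _ hφ.continuous hφc (hDc i))]
  exact Finset.sum_congr rfl (fun i _ => key i)

lemma aux_norm {N : ℕ} (x : E N) (hx : x ≠ 0) :
    HasFDerivAt (fun y : E N => ‖y‖) (‖x‖⁻¹ • innerSL ℝ x) x := by
  have h := (hasStrictFDerivAt_norm_sq x).hasFDerivAt.sqrt (by positivity)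
  have : (fun y : E N => √(‖y‖ ^ 2)) = fun y => ‖y‖ := by
    funext y; exact Real.sqrt_sq (norm_nonneg _)
  rw [this] at h
  have e : ((1 / (2 * √(‖x‖ ^ 2))) • 2 • (innerSL ℝ) x) = ‖x‖⁻¹ • innerSL ℝ x := by
    rw [Real.sqrt_sq (norm_nonneg _)]
    ext v
    have : ‖x‖ ≠ 0 := by simpa using hx
    simp
    field_simp
  rw [← e]
  exact h

lemma aux_radial {N : ℕ} (f g : ℝ → ℝ) (ρ : ℝ) (hρ : 0 < ρ)
    (hf : ∀ r, 0 < r → HasDerivAt f (r * g r) r) (hf0 : ∀ r, r < ρ → f r = f 0) (x : E N) :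
    HasFDerivAt (fun y : E N => f ‖y‖) (g ‖x‖ • innerSL ℝ x) x := by
  by_cases hx : x = 0
  · subst hx
    simp only [map_zero, smul_zero]
    refine (hasFDerivAt_const (f 0) (0 : E N)).congr_of_eventuallyEq ?_
    filter_upwards [Metric.ball_mem_nhds (0 : E N) hρ] with y hy
    exact hf0 _ (by simpa using hy)
  · have h0 : 0 < ‖x‖ := norm_pos_iff.2 hx
    have := (hf _ h0).comp_hasFDerivAt x (aux_norm x hx)
    have e : (‖x‖ * g ‖x‖) • ‖x‖⁻¹ • (innerSL ℝ) x = g ‖x‖ • innerSL ℝ x := by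
      ext v
      simp
      field_simp
    rw [← e]
    exact this

lemma aux_psi (N : ℕ) (hN : 5 ≤ N) (h : ℝ → ℝ) (hc : Continuous h) (hn : ∀ r, 0 ≤ h r)
    (hcs : HasCompactSupport h) (ρ : ℝ) (hρ : 0 < ρ) (h0 : ∀ r, r < 2 * ρ → h r = 0) :
    ∃ ψ : E N → ℝ, Continuous ψ ∧
      (∀ φ : E N → ℝ, ContDiff ℝ (⊤ : ℕ∞) φ → HasCompactSupport φ →
        ∫ x, lapl φ x * ψ x = ∫ x, φ x * h ‖x‖) ∧
      ∀ x, |ψ x| ≤ (∫ s in Ioi (0:ℝ), s ^ (N - 1) * h s) * (max ‖x‖ ρ) ^ (2 - N : ℝ) := by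
  have hN' : (5:ℝ) ≤ N := by exact_mod_cast hN
  set J := ∫ s in Ioi (0:ℝ), s ^ (N - 1) * h s with hJ
  set k : ℝ → ℝ := fun s => s ^ (N - 1) * h s with hk
  have hkc : Continuous k := by fun_prop
  have hkcs : HasCompactSupport k := hcs.mul_left
  have hki : Integrable k := hkc.integrable_of_hasCompactSupport hkcs
  have hkn : ∀ s, 0 ≤ k s := by
    intro s
    by_cases hs : s < 2 * ρ
    · simp [hk, h0 s hs]
    · have : 0 ≤ s := by linarith
      exact mul_nonneg (pow_nonneg this _) (hn s)
  set H : ℝ → ℝ := fun r => ∫ s in (0:ℝ)..r, k s with hH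
  have hHd : ∀ r, HasDerivAt H (k r) r := fun r => (hkc.integral_hasStrictDerivAt 0 r).hasDerivAt
  have hHc : Continuous H := continuous_iff_continuousAt.2 fun r => (hHd r).continuousAt
  have hHadd : ∀ r, H r + ∫ s in Ioi r, k s = J := fun r =>
    intervalIntegral.integral_interval_add_Ioi hki.integrableOn hki.integrableOn
  have hHle : ∀ r, H r ≤ J := by
    intro r
    have : 0 ≤ ∫ s in Ioi r, k s := setIntegral_nonneg measurableSet_Ioi (fun s _ => hkn s)
    linarith [hHadd r]
  have hH0 : ∀ r, r < 2 * ρ → H r = 0 := by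
    intro r hr
    rw [hH]
    simp only
    rw [intervalIntegral.integral_congr (g := fun _ => (0:ℝ))]
    · simp
    · intro s hs
      have : s ≤ max 0 r := hs.2
      have : s < 2 * ρ := lt_of_le_of_lt this (max_lt (by linarith) hr)
      simp [hk, h0 s this]
  have hHn : ∀ r, 0 ≤ H r := by
    intro r
    by_cases hr : r < 2 * ρ
    · rw [hH0 r hr]
    · exact intervalIntegral.integral_nonneg (by linarith) (fun s _ => hkn s)
  have hJn : 0 ≤ J := (hHn 0).trans (hHle 0)
  have hm : ∀ r, 0 < max r ρ := fun r => lt_max_of_lt_right hρ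
  set b : ℝ → ℝ := fun r => H r / (max r ρ) ^ N with hb
  have hbc : Continuous b := by
    refine hHc.div (by fun_prop) (fun r => (pow_pos (hm r) _).ne')
  have hb0 : ∀ r, r < 2 * ρ → b r = 0 := fun r hr => by simp [hb, hH0 r hr]
  set q : ℝ → ℝ := fun r => r * b r with hq
  have hqc : Continuous q := by fun_prop
  have hq0 : ∀ r, r < 2 * ρ → q r = 0 := fun r hr => by simp [hq, hb0 r hr]
  have hqn : ∀ r, 0 ≤ q r := by
    intro r
    by_cases hr : r < 2 * ρ
    · rw [hq0 r hr]
    · exact mul_nonneg (by linarith) (div_nonneg (hHn r) (pow_pos (hm r) _).le)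
  have hqle : ∀ r, ρ < r → q r ≤ J * r ^ (1 - N : ℝ) := by
    intro r hr
    have hr0 : 0 < r := hρ.trans hr
    have e : q r = H r * r ^ (1 - N : ℝ) := by
      simp only [hq, hb]
      rw [max_eq_left hr.le, Real.rpow_sub hr0, Real.rpow_one, Real.rpow_natCast]
      ring
    rw [e]
    exact mul_le_mul_of_nonneg_right (hHle r) (Real.rpow_nonneg hr0.le _)
  have hgi : ∀ c, 0 < c → IntegrableOn (fun r : ℝ => J * r ^ (1 - N : ℝ)) (Ioi c) := fun c hc =>
    (integrableOn_Ioi_rpow_of_lt (by linarith) hc).const_mul J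
  have hqi : IntegrableOn q (Ioi ρ) := by
    refine Integrable.mono' (hgi ρ hρ) hqc.aestronglyMeasurable ?_
    filter_upwards [ae_restrict_mem measurableSet_Ioi] with r hr
    rw [Real.norm_of_nonneg (hqn r)]
    exact hqle r hr
  have hqi' : ∀ r, IntegrableOn q (Ioi r) := by
    intro r
    have : Integrable q := by
      rw [← integrableOn_univ, ← Iic_union_Ioi (a := ρ)]
      refine IntegrableOn.union ?_ hqi
      refine IntegrableOn.congr_fun (f := fun _ => (0:ℝ)) (by simp) ?_ measurableSet_Iic
      intro s hs
      have : s ≤ ρ := hs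
      simp [hq0 s (by linarith)]
    exact this.integrableOn
  set Q : ℝ → ℝ := fun r => (∫ s in (0:ℝ)..r, q s) - ∫ s in Ioi (0:ℝ), q s with hQ
  have hQd : ∀ r, HasDerivAt Q (q r) r := fun r =>
    ((hqc.integral_hasStrictDerivAt 0 r).hasDerivAt).sub_const _
  have hQe : ∀ r, Q r = - ∫ s in Ioi r, q s := by
    intro r
    have := intervalIntegral.integral_interval_add_Ioi (hqi' 0) (hqi' r)
    simp only [hQ]
    linarith
  have hQ0 : ∀ r, r < 2 * ρ → Q r = Q 0 := by
    intro r hr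
    simp only [hQ]
    rw [intervalIntegral.integral_congr (g := fun _ => (0:ℝ))]
    · simp
    · intro s hs
      have : s ≤ max 0 r := hs.2
      have : s < 2 * ρ := lt_of_le_of_lt this (max_lt (by linarith) hr)
      simp [hq0 s this]
  have hQb : ∀ r, |Q r| ≤ J * (max r ρ) ^ (2 - N : ℝ) := by
    intro r
    rw [hQe, abs_neg, abs_of_nonneg (setIntegral_nonneg measurableSet_Ioi (fun s _ => hqn s))]
    have e1 : ∫ s in Ioi r, q s = ∫ s in Ioi (max r ρ), q s := by
      refine setIntegral_eq_of_subset_of_forall_sdiff_eq_zero measurableSet_Ioi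
        (Ioi_subset_Ioi (le_max_left _ _)) ?_
      rintro s ⟨hs1, hs2⟩
      simp only [mem_Ioi, not_lt] at hs1 hs2
      apply hq0
      rcases le_max_iff.1 hs2 with h' | h' <;> linarith
    rw [e1]
    calc ∫ s in Ioi (max r ρ), q s ≤ ∫ s in Ioi (max r ρ), J * s ^ (1 - N : ℝ) := by
          refine setIntegral_mono_on (hqi' _) (hgi _ (hm r)) measurableSet_Ioi ?_
          intro s hs
          exact hqle s (lt_of_le_of_lt (le_max_right _ _) hs)
      _ = J * ((max r ρ) ^ (2 - N : ℝ) / (N - 2)) := by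
          rw [integral_const_mul, integral_Ioi_rpow_of_lt (by linarith) (hm r)]
          have : (1 - N + 1 : ℝ) = 2 - N := by ring
          rw [this, ← neg_sub (N : ℝ) 2, neg_div_neg_eq]
      _ ≤ _ := by
          refine mul_le_mul_of_nonneg_left ?_ hJn
          exact div_le_self (Real.rpow_nonneg (hm r).le _) (by linarith)
  set β : ℝ → ℝ := fun r => (h r - N * b r) / (max r ρ) ^ 2 with hβ
  have hβc : Continuous β := by
    refine Continuous.div (by fun_prop) (by fun_prop) (fun r => (pow_pos (hm r) _).ne')
  have hbd : ∀ r, 0 < r → HasDerivAt b (r * β r) r := by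
    intro r hr
    by_cases hr2 : r < 2 * ρ
    · have e : r * β r = 0 := by simp [hβ, h0 r hr2, hb0 r hr2]
      rw [e]
      refine (hasDerivAt_const r (0:ℝ)).congr_of_eventuallyEq ?_
      filter_upwards [Iio_mem_nhds hr2] with s hs using hb0 s hs
    · have hr3 : ρ < r := by linarith
      have hd := (hHd r).div (hasDerivAt_pow N r) (pow_pos hr _).ne'
      have : r * β r = (k r * r ^ N - H r * (N * r ^ (N - 1))) / (r ^ N) ^ 2 := by
        simp only [hβ, hb, hk]
        rw [max_eq_left hr3.le]
        obtain ⟨n, rfl⟩ : ∃ n, N = n + 1 := ⟨N - 1, by omega⟩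
        simp only [Nat.add_sub_cancel]
        field_simp
        ring
      rw [this]
      refine hd.congr_of_eventuallyEq ?_
      filter_upwards [Ioi_mem_nhds hr3] with s hs
      have : ρ < s := hs
      simp only [hb, Pi.div_apply]
      rw [max_eq_left this.le]
  have F1 : ∀ x : E N, HasFDerivAt (fun y : E N => Q ‖y‖) (b ‖x‖ • innerSL ℝ x) x :=
    aux_radial Q b (2 * ρ) (by linarith) (fun r _ => hQd r) hQ0
  have F2 : ∀ x : E N, HasFDerivAt (fun y : E N => b ‖y‖) (β ‖x‖ • innerSL ℝ x) x :=
    aux_radial b β (2 * ρ) (by linarith) hbd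
      (fun r hr => by rw [hb0 r hr, hb0 0 (by linarith)])
  have F3 : ∀ (i : Fin N) (x : E N), HasFDerivAt (fun y : E N => b ‖y‖ * y i)
      (b ‖x‖ • (EuclideanSpace.proj i : E N →L[ℝ] ℝ) + x i • (β ‖x‖ • innerSL ℝ x)) x := by
    intro i x
    exact (F2 x).mul (EuclideanSpace.proj i : E N →L[ℝ] ℝ).hasFDerivAt
  refine ⟨fun x => Q ‖x‖, ?_, ?_, fun x => hQb _⟩
  · exact (continuous_iff_continuousAt.2 fun r => (hQd r).continuousAt).comp continuous_norm
  · intro φ hφ hφc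
    rw [aux_ibp φ (fun x => Q ‖x‖) hφ hφc (fun x => (F1 x).differentiableAt)
      (fun i x => b ‖x‖ * x i) (fun i x => b ‖x‖ + x i * (β ‖x‖ * x i))
      (fun i x => (F3 i x).differentiableAt) (fun i => by fun_prop)]
    · congr 1
      ext x
      congr 1
      have e : ∑ i : Fin N, x i * (β ‖x‖ * x i) = β ‖x‖ * ‖x‖ ^ 2 := by
        rw [EuclideanSpace.real_norm_sq_eq, Finset.mul_sum]
        refine Finset.sum_congr rfl (fun i _ => ?_)
        ring
      rw [Finset.sum_add_distrib, e]
      simp only [Finset.sum_const, Finset.card_univ, Fintype.card_fin, nsmul_eq_mul]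
      by_cases hr : ‖x‖ < 2 * ρ
      · simp [hβ, h0 _ hr, hb0 _ hr]
      · have hr3 : ρ < ‖x‖ := by linarith
        have : 0 < ‖x‖ := hρ.trans hr3
        simp only [hβ]
        rw [max_eq_left hr3.le]
        field_simp
        ring
    · intro i x
      rw [(F1 x).fderiv]
      simp [EuclideanSpace.inner_single_right]
    · intro i x
      rw [(F3 i x).fderiv]
      simp [EuclideanSpace.inner_single_right]

lemma aux_lapl_cont {N : ℕ} (φ : E N → ℝ) (hφ : ContDiff ℝ (⊤ : ℕ∞) φ) : Continuous (lapl φ) := by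
  have hd : ∀ i : Fin N, ContDiff ℝ (⊤ : ℕ∞)
      (fun y => fderiv ℝ φ y (EuclideanSpace.single i 1)) := by
    intro i
    exact (hφ.fderiv_right (m := (⊤ : ℕ∞)) (by simp)).clm_apply contDiff_const
  have hdd : ∀ i : Fin N, Continuous
      (fun y => fderiv ℝ (fun y => fderiv ℝ φ y (EuclideanSpace.single i 1)) y
        (EuclideanSpace.single i 1)) := by
    intro i
    exact (((hd i).fderiv_right (m := (⊤ : ℕ∞)) (by simp)).clm_apply contDiff_const).continuous
  unfold lapl
  exact continuous_finsetSum _ (fun i _ => hdd i)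

lemma aux_holder {N : ℕ} (f g : E N → ℝ) (p q : ℝ≥0∞) [p.HolderTriple q 1]
    (hf : AEStronglyMeasurable f volume) (hg : AEStronglyMeasurable g volume) :
    ‖∫ x, f x * g x‖ₑ ≤ eLpNorm f p volume * eLpNorm g q volume := by
  refine (enorm_integral_le_lintegral_enorm _).trans ?_
  have := eLpNorm_smul_le_mul_eLpNorm (p := p) (q := q) (r := 1) (μ := volume) hg hf
  rw [eLpNorm_one_eq_lintegral_enorm] at this
  simpa using this

lemma aux_L2 (N : ℕ) (hN : 5 ≤ N) :
    MemLp (fun x : E N => (max ‖x‖ 1) ^ (2 - N : ℝ)) 2 volume := by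
  have hN' : (5:ℝ) ≤ N := by exact_mod_cast hN
  have hpos : ∀ x : E N, 0 < max ‖x‖ 1 := fun x => lt_max_of_lt_right one_pos
  have hcont : Continuous (fun x : E N => (max ‖x‖ 1) ^ (2 - N : ℝ)) := by
    refine Continuous.rpow_const (by fun_prop) (fun x => Or.inl (hpos x).ne')
  rw [memLp_two_iff_integrable_sq hcont.aestronglyMeasurable]
  have hi : Integrable (fun x : E N => (1 + ‖x‖) ^ (-(2 * N - 4 : ℝ))) :=
    integrable_one_add_norm (by simp; linarith)
  refine (hi.const_mul ((2:ℝ) ^ (2 * N - 4 : ℝ))).mono' (hcont.pow 2).aestronglyMeasurable ?_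
  refine Eventually.of_forall (fun x => ?_)
  rw [Real.norm_of_nonneg (sq_nonneg _), ← Real.rpow_natCast, ← Real.rpow_mul (hpos x).le]
  have h1 : (1 + ‖x‖) / 2 ≤ max ‖x‖ 1 := by
    have := le_max_left ‖x‖ 1
    have := le_max_right ‖x‖ 1
    linarith
  have h2 : 0 < (1 + ‖x‖) / 2 := by positivity
  calc (max ‖x‖ 1) ^ ((2 - N : ℝ) * (2:ℕ)) ≤ ((1 + ‖x‖) / 2) ^ ((2 - N : ℝ) * (2:ℕ)) :=
        Real.rpow_le_rpow_of_nonpos h2 h1 (by push_cast; linarith)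
    _ = _ := by
        have e : (2 - N : ℝ) * (2:ℕ) = -(2 * N - 4) := by push_cast; ring
        rw [e, Real.div_rpow (by positivity) (by norm_num), Real.rpow_neg (by norm_num : (0:ℝ) ≤ 2),
          div_inv_eq_mul, mul_comm]

lemma aux_scale (N : ℕ) (ρ : ℝ) (hρ : 0 < ρ) :
    eLpNorm (fun x : E N => (max ‖x‖ ρ) ^ (2 - N : ℝ)) 2 volume =
      ENNReal.ofReal (ρ ^ (-((N - 4) / 2) : ℝ)) *
        eLpNorm (fun x : E N => (max ‖x‖ 1) ^ (2 - N : ℝ)) 2 volume := by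
  have hpos : ∀ x : E N, 0 < max ‖x‖ 1 := fun x => lt_max_of_lt_right one_pos
  have hcont : Continuous (fun x : E N => (max ‖x‖ 1) ^ (2 - N : ℝ)) := by
    refine Continuous.rpow_const (by fun_prop) (fun x => Or.inl (hpos x).ne')
  have e : (fun x : E N => (max ‖x‖ ρ) ^ (2 - N : ℝ)) =
      (ρ ^ (2 - N : ℝ)) • ((fun x : E N => (max ‖x‖ 1) ^ (2 - N : ℝ)) ∘ (fun x => ρ⁻¹ • x)) := by
    ext x
    simp only [Pi.smul_apply, Function.comp_apply, smul_eq_mul]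
    rw [← Real.mul_rpow hρ.le (hpos _).le, norm_smul, norm_inv, Real.norm_of_nonneg hρ.le,
      mul_max_of_nonneg _ _ hρ.le]
    congr 2
    · field_simp
    · simp
  rw [e, eLpNorm_const_smul, ← eLpNorm_map_measure hcont.aestronglyMeasurable (by fun_prop),
    Measure.map_addHaar_smul _ (by positivity),
    eLpNorm_smul_measure_of_ne_top (by simp), smul_eq_mul, ← mul_assoc]
  congr 1
  rw [Real.enorm_of_nonneg (by positivity)]
  have h1 : |((ρ⁻¹ : ℝ) ^ Module.finrank ℝ (E N))⁻¹| = ρ ^ (N : ℝ) := by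
    rw [inv_pow, inv_inv, abs_of_nonneg (by positivity)]
    simp
  rw [h1, ENNReal.ofReal_rpow_of_nonneg (by positivity) (by simp), ← ENNReal.ofReal_mul (by positivity),
    ← Real.rpow_mul hρ.le, ← Real.rpow_add hρ]
  congr 2
  simp
  ring

lemma aux_twoSS (N : ℕ) (hN : 5 ≤ N) : 1 ≤ twoSS N := by
  unfold twoSS
  have e : ((N : ℝ≥0∞) - 4) = ((N - 4 : ℕ) : ℝ≥0∞) := by push_cast; rfl
  rw [e, ENNReal.le_div_iff_mul_le (Or.inl (Nat.cast_ne_zero.2 (by omega))) (Or.inl (by simp))]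
  rw [one_mul]
  exact_mod_cast (by omega : N - 4 ≤ 2 * N)

lemma aux_weak (N : ℕ) (hN : 5 ≤ N) : ∃ C : ℝ, 0 ≤ C ∧ ∀ u w : E N → ℝ, MemD22 N u w →
    eLpNorm w 2 volume ≤ 1 → ∀ (h : ℝ → ℝ), Continuous h → (∀ r, 0 ≤ h r) →
    HasCompactSupport h → ∀ ρ : ℝ, 0 < ρ → (∀ r, r < 2 * ρ → h r = 0) →
    |∫ x, u x * h ‖x‖| ≤
      C * ρ ^ (-((N - 4) / 2) : ℝ) * ∫ s in Ioi (0:ℝ), s ^ (N - 1) * h s := by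
  set A := eLpNorm (fun x : E N => (max ‖x‖ 1) ^ (2 - N : ℝ)) 2 volume with hA
  have hAtop : A ≠ ⊤ := (aux_L2 N hN).2.ne
  refine ⟨A.toReal, ENNReal.toReal_nonneg, ?_⟩
  rintro u w ⟨hu, hw, φ, hφ, hlim1, hlim2⟩ hw1 h hc hn hcs ρ hρ h0
  obtain ⟨ψ, hψc, hψi, hψb⟩ := aux_psi N hN h hc hn hcs ρ hρ h0
  set J := ∫ s in Ioi (0:ℝ), s ^ (N - 1) * h s with hJ
  have hJn : 0 ≤ J := setIntegral_nonneg measurableSet_Ioi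
    (fun s hs => mul_nonneg (pow_nonneg (le_of_lt hs) _) (hn s))
  have hψ2 : eLpNorm ψ 2 volume ≤ ENNReal.ofReal (A.toReal * ρ ^ (-((N - 4) / 2) : ℝ) * J) := by
    calc eLpNorm ψ 2 volume
        ≤ eLpNorm (J • fun x : E N => (max ‖x‖ ρ) ^ (2 - N : ℝ)) 2 volume := by
          refine eLpNorm_mono (fun x => ?_)
          refine (hψb x).trans ?_
          exact le_abs_self _
      _ = _ := by
          rw [eLpNorm_const_smul, aux_scale N ρ hρ, Real.enorm_of_nonneg hJn,
            ENNReal.ofReal_mul (by positivity), ENNReal.ofReal_mul (by positivity),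
            ENNReal.ofReal_toReal hAtop]
          ring
  have : Fact (1 ≤ twoSS N) := ⟨aux_twoSS N hN⟩
  set p := twoSS N
  set p' := p.conjExponent
  have hhc : Continuous (fun x : E N => h ‖x‖) := hc.comp continuous_norm
  have hhcs : HasCompactSupport (fun x : E N => h ‖x‖) := by
    obtain ⟨B, hB⟩ := hcs.isCompact.isBounded.subset_closedBall (0:ℝ)
    refine HasCompactSupport.intro (isCompact_closedBall (0 : E N) B) (fun x hx => ?_)
    by_contra hne
    have := hB (subset_tsupport _ hne)
    simp at this hx
    linarith
  have hhL : MemLp (fun x : E N => h ‖x‖) p' volume := hhc.memLp_of_hasCompactSupport hhcs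
  have hhL2 : MemLp (fun x : E N => h ‖x‖) p' volume := hhL
  have hiu : Integrable (fun x => u x * h ‖x‖) := hu.integrable_mul hhL
  have hle : ∀ n, ‖∫ x, u x * h ‖x‖‖ₑ ≤
      eLpNorm (fun x => φ n x - u x) p volume * eLpNorm (fun x : E N => h ‖x‖) p' volume +
      (eLpNorm (fun x => lapl (φ n) x - w x) 2 volume + 1) *
        ENNReal.ofReal (A.toReal * ρ ^ (-((N - 4) / 2) : ℝ) * J) := by
    intro n
    have hφL : MemLp (φ n) p volume := (hφ n).1.continuous.memLp_of_hasCompactSupport (hφ n).2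
    have hiφ : Integrable (fun x => φ n x * h ‖x‖) := hφL.integrable_mul hhL
    have hlc := aux_lapl_cont (φ n) (hφ n).1
    have e1 : ∫ x, u x * h ‖x‖ = (∫ x, lapl (φ n) x * ψ x) - ∫ x, (φ n x - u x) * h ‖x‖ := by
      rw [hψi _ (hφ n).1 (hφ n).2, ← integral_sub hiφ]
      · congr 1; ext x; ring
      · simp_rw [sub_mul]; exact hiφ.sub hiu
    rw [e1]
    refine enorm_sub_le.trans ?_
    rw [add_comm]
    gcongr
    · exact aux_holder _ _ p p' ((hφ n).1.continuous.aestronglyMeasurable.sub hu.1)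
        hhc.aestronglyMeasurable
    · refine (aux_holder _ _ 2 2 hlc.aestronglyMeasurable hψc.aestronglyMeasurable).trans ?_
      gcongr
      have e2 : lapl (φ n) = (fun x => lapl (φ n) x - w x) + w := by ext x; simp
      have e3 := eLpNorm_add_le (hlc.aestronglyMeasurable.sub hw.1) hw.1 (p := 2) (by norm_num)
      calc eLpNorm (lapl (φ n)) 2 volume
          = eLpNorm ((fun x => lapl (φ n) x - w x) + w) 2 volume := by rw [← e2]
        _ ≤ eLpNorm (fun x => lapl (φ n) x - w x) 2 volume + eLpNorm w 2 volume := e3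
        _ ≤ _ := by gcongr
  have hT : Tendsto (fun n =>
      eLpNorm (fun x => φ n x - u x) p volume * eLpNorm (fun x : E N => h ‖x‖) p' volume +
      (eLpNorm (fun x => lapl (φ n) x - w x) 2 volume + 1) *
        ENNReal.ofReal (A.toReal * ρ ^ (-((N - 4) / 2) : ℝ) * J)) atTop
      (𝓝 (0 * eLpNorm (fun x : E N => h ‖x‖) p' volume +
      (0 + 1) * ENNReal.ofReal (A.toReal * ρ ^ (-((N - 4) / 2) : ℝ) * J))) := by
    refine (ENNReal.Tendsto.mul_const hlim1 (Or.inr hhL.2.ne)).add ?_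
    exact ENNReal.Tendsto.mul_const (hlim2.add tendsto_const_nhds) (Or.inr ENNReal.ofReal_ne_top)
  have := ge_of_tendsto' hT hle
  rw [zero_mul, zero_add, zero_add, one_mul, ← ofReal_norm,
    ENNReal.ofReal_le_ofReal_iff (by positivity)] at this
  exact this

lemma aux_nontriv (N : ℕ) (hN : 5 ≤ N) : Nontrivial (E N) := by
  have : Nonempty (Fin N) := ⟨⟨0, by omega⟩⟩
  infer_instance

lemma aux_null (N : ℕ) (hN : 5 ≤ N) (P : ℝ → Prop)
    (hP : ∀ᵐ r ∂(volume.restrict (Ioi (0:ℝ))), P r) : ∀ᵐ x : E N, P ‖x‖ := by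
  have := aux_nontriv N hN
  obtain ⟨A, hA, hAm, hA0⟩ := exists_measurable_superset_of_null (ae_iff.1 hP)
  have hae : ∀ᵐ r ∂(volume.restrict (Ioi (0:ℝ))), r ∉ A := measure_eq_zero_iff_ae_notMem.1 hA0
  set f : ℝ → ℝ := A.indicator (fun _ => 1) with hf
  have hz : (fun y : ℝ => y ^ (Module.finrank ℝ (E N) - 1) • f y)
      =ᵐ[volume.restrict (Ioi (0:ℝ))] fun _ => 0 := by
    filter_upwards [hae] with r hr
    simp [hf, hr]
  have hi : Integrable (fun x : E N => f ‖x‖) volume :=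
    (integrable_fun_norm_addHaar volume).2 ((integrable_zero _ _ _).congr hz.symm)
  have h0 : ∫ x : E N, f ‖x‖ = 0 := by
    rw [integral_fun_norm_addHaar volume f, integral_congr_ae hz]
    simp
  have hfn : ∀ r, 0 ≤ f r := fun r => indicator_nonneg (fun _ _ => zero_le_one) r
  rw [integral_eq_zero_iff_of_nonneg (fun x => hfn _) hi] at h0
  filter_upwards [h0] with x hx
  by_contra hne
  have : ‖x‖ ∈ A := hA hne
  simp [hf, this] at hx

lemma aux_pointwise (N : ℕ) (hN : 5 ≤ N) : ∃ C : ℝ, 0 ≤ C ∧ ∀ u w : E N → ℝ, MemD22 N u w →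
    eLpNorm w 2 volume ≤ 1 → IsRadial u →
    ∀ᵐ x : E N, |u x| ≤ C * ‖x‖ ^ (-((N - 4) / 2) : ℝ) := by
  obtain ⟨C, hC, hweak⟩ := aux_weak N hN
  have := aux_nontriv N hN
  set κ : ℝ := N * (volume : Measure (E N)).real (Metric.ball 0 1) with hκ
  have hκ0 : 0 < κ := by
    have : 0 < (volume : Measure (E N)).real (Metric.ball 0 1) :=
      ENNReal.toReal_pos (Metric.measure_ball_pos _ _ one_pos).ne' measure_ball_lt_top.ne
    have : (0:ℝ) < N := by exact_mod_cast (by omega : 0 < N)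
    positivity
  refine ⟨C / κ * (4:ℝ) ^ ((N - 4) / 2 : ℝ), by positivity, ?_⟩
  intro u w hD hw hrad
  set U : ℝ → ℝ := fun r => u (EuclideanSpace.single (⟨0, by omega⟩ : Fin N) r) with hU
  have hUu : ∀ x, u x = U ‖x‖ := by
    intro x
    apply hrad
    simp
  set f : ℝ → ℝ := (Ioi (0:ℝ)).indicator (fun s => s ^ (N - 1) * U s) with hf
  set g : ℝ → ℝ := (Ioi (0:ℝ)).indicator (fun s => s ^ (N - 1)) with hg
  have hfr : Module.finrank ℝ (E N) = N := by simp
  have hloc : LocallyIntegrable f volume := by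
    intro x
    refine ⟨Iio (x + 1), Iio_mem_nhds (by linarith), ?_⟩
    rw [hf, integrableOn_indicator_iff measurableSet_Ioi]
    have hul : LocallyIntegrable u volume := hD.1.locallyIntegrable (aux_twoSS N hN)
    have h1 : IntegrableOn u (Metric.ball (0 : E N) (x + 1)) volume :=
      (hul.integrableOn_isCompact (isCompact_closedBall 0 (x + 1))).mono_set
        Metric.ball_subset_closedBall
    have h2 : IntegrableOn (fun x : E N => U ‖x‖) (Metric.ball (0 : E N) (x + 1)) volume :=
      h1.congr_fun (fun y _ => hUu y) measurableSet_ball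
    rw [integrableOn_fun_norm_addHaar, hfr] at h2
    rw [Ioi_inter_Iio]
    exact h2
  have hlocg : LocallyIntegrable g volume := by
    have : Continuous (fun s : ℝ => s ^ (N - 1)) := by fun_prop
    exact this.locallyIntegrable.indicator measurableSet_Ioi
  let b : ℕ → ContDiffBump (0:ℝ) := fun n =>
    ⟨1 / ((n:ℝ) + 1) / 2, 1 / ((n:ℝ) + 1), by positivity, half_lt_self (by positivity)⟩
  have hb1 : Tendsto (fun n => (b n).rOut) atTop (𝓝 0) := tendsto_one_div_add_atTop_nhds_zero_nat
  have hb2 : ∀ᶠ n in atTop, (b n).rOut ≤ 2 * (b n).rIn := by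
    refine Eventually.of_forall (fun n => ?_)
    show 1 / ((n:ℝ) + 1) ≤ 2 * (1 / ((n:ℝ) + 1) / 2)
    linarith
  have c1 := ContDiffBump.ae_convolution_tendsto_right_of_locallyIntegrable hb1 hb2 hloc
  have c2 := ContDiffBump.ae_convolution_tendsto_right_of_locallyIntegrable hb1 hb2 hlocg
  have hae : ∀ᵐ r ∂(volume.restrict (Ioi (0:ℝ))),
      |U r| ≤ C / κ * (4:ℝ) ^ ((N - 4) / 2 : ℝ) * r ^ (-((N - 4) / 2) : ℝ) := by
    rw [ae_restrict_iff' measurableSet_Ioi]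
    filter_upwards [c1, c2] with r t1 t2 hr
    have hr : 0 < r := hr
    have hev : ∀ᶠ n in atTop,
        κ * |convolution ((b n).normed volume) f (ContinuousLinearMap.lsmul ℝ ℝ) volume r| ≤
        C * (r / 4) ^ (-((N - 4) / 2) : ℝ) *
          convolution ((b n).normed volume) g (ContinuousLinearMap.lsmul ℝ ℝ) volume r := by
      have : ∀ᶠ n in atTop, (b n).rOut < r / 2 := hb1.eventually_lt_const (by linarith)
      filter_upwards [this] with n hn
      set h : ℝ → ℝ := fun s => (b n).normed volume (r - s) with hh
      have hhc : Continuous h := (b n).continuous_normed.comp (by fun_prop)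
      have hsupp : ∀ s, (b n).rOut ≤ |r - s| → h s = 0 := by
        intro s hs
        by_contra hne
        have : r - s ∈ Function.support ((b n).normed volume) := hne
        rw [(b n).support_normed_eq] at this
        simp at this
        linarith
      have hcs : HasCompactSupport h := by
        refine HasCompactSupport.intro (isCompact_closedBall r (b n).rOut) (fun s hs => ?_)
        apply hsupp
        rw [Metric.mem_closedBall, dist_comm, Real.dist_eq, not_le] at hs
        exact hs.le
      have hk := hweak u w hD hw h hhc (fun s => (b n).nonneg_normed _) hcs (r / 4) (by linarith)
        (fun s hs => hsupp s (by rw [abs_of_nonneg (by linarith)]; linarith))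
      have e1 : ∫ x, u x * h ‖x‖ =
          κ * convolution ((b n).normed volume) f (ContinuousLinearMap.lsmul ℝ ℝ) volume r := by
        have : (fun x => u x * h ‖x‖) = fun x : E N => (fun s => U s * h s) ‖x‖ := by
          ext x; rw [hUu x]
        rw [this, integral_fun_norm_addHaar volume (fun s => U s * h s), convolution_eq_swap,
          hfr, nsmul_eq_mul, smul_eq_mul, ← mul_assoc]
        congr 1
        rw [← integral_indicator measurableSet_Ioi]
        congr 1
        ext s
        by_cases hs : s ∈ Ioi (0:ℝ) <;> simp [hf, hs, hh]
        ring
      have e2 : ∫ s in Ioi (0:ℝ), s ^ (N - 1) * h s =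
          convolution ((b n).normed volume) g (ContinuousLinearMap.lsmul ℝ ℝ) volume r := by
        rw [convolution_eq_swap, ← integral_indicator measurableSet_Ioi]
        congr 1
        ext s
        by_cases hs : s ∈ Ioi (0:ℝ) <;> simp [hg, hs, hh]
        ring
      rw [e1, e2, abs_mul, abs_of_pos hκ0] at hk
      exact hk
    have hlim := le_of_tendsto_of_tendsto (t1.abs.const_mul κ) (t2.const_mul _) hev
    have hr' : r ∈ Ioi (0:ℝ) := hr
    simp only [hf, hg, indicator_of_mem hr', abs_mul, abs_pow, abs_of_pos hr] at hlim
    have hp : 0 < r ^ (N - 1) := by positivity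
    have e3 : (r / 4) ^ (-((N - 4) / 2) : ℝ) =
        (4:ℝ) ^ ((N - 4) / 2 : ℝ) * r ^ (-((N - 4) / 2) : ℝ) := by
      rw [Real.div_rpow hr.le (by norm_num), Real.rpow_neg (by norm_num : (0:ℝ) ≤ 4),
        div_inv_eq_mul, mul_comm]
    rw [e3] at hlim
    have h4 : κ * |U r| ≤ C * ((4:ℝ) ^ ((N - 4) / 2 : ℝ) * r ^ (-((N - 4) / 2) : ℝ)) := by
      refine le_of_mul_le_mul_right ?_ hp
      linarith
    rw [div_mul_eq_mul_div, div_mul_eq_mul_div, le_div_iff₀ hκ0]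
    linarith
  filter_upwards [aux_null N hN _ hae] with x hx
  rw [hUu x]
  exact hx

lemma aux_real (n ν α β q δ Λ C R r v f Kr : ℝ) (hβ : 0 ≤ β) (hβ1 : β ≤ 1) (hq0 : 0 < q)
    (hq : 2 * β < q) (hδ : 0 < δ) (hδe : ν * q - 2 * ν * β - α = n * (1 - β) + 2 * δ)
    (hΛ : 0 ≤ Λ) (hC : 0 ≤ C) (hR : 1 ≤ R) (hr : R ≤ r) (hv : 0 ≤ v) (hf : 0 ≤ f)
    (hfr : f ≤ C * r ^ (-ν)) (hK : Kr ≤ Λ * (r ^ α * v ^ β)) :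
    Kr * f ^ q ≤ Λ * C ^ (q - 2 * β) * R ^ (-δ) * (r ^ (-(n + δ)) + v * f ^ 2) := by
  have hr1 : 1 ≤ r := hR.trans hr
  have hr0 : 0 < r := by linarith
  have hR0 : 0 < R := by linarith
  have e1 : f ^ q = (f ^ 2) ^ β * f ^ (q - 2 * β) := by
    rw [← Real.rpow_natCast, ← Real.rpow_mul hf, ← Real.rpow_add_of_nonneg hf
      (by push_cast; positivity) (by linarith)]
    congr 1
    push_cast
    ring
  have e2 : f ^ (q - 2 * β) ≤ C ^ (q - 2 * β) * r ^ (-ν * (q - 2 * β)) := by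
    rw [Real.rpow_mul hr0.le, ← Real.mul_rpow hC (by positivity)]
    exact Real.rpow_le_rpow hf hfr (by linarith)
  have e3 : r ^ (α + -ν * (q - 2 * β)) ≤ R ^ (-δ) * (r ^ (-(n + δ))) ^ (1 - β) := by
    calc r ^ (α + -ν * (q - 2 * β)) ≤ r ^ (-δ + -(n + δ) * (1 - β)) := by
          refine Real.rpow_le_rpow_of_exponent_le hr1 ?_
          nlinarith [mul_nonneg hδ.le hβ]
      _ = r ^ (-δ) * (r ^ (-(n + δ))) ^ (1 - β) := by
          rw [Real.rpow_add hr0, Real.rpow_mul hr0.le]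
      _ ≤ _ := by
          refine mul_le_mul_of_nonneg_right ?_ (by positivity)
          exact Real.rpow_le_rpow_of_nonpos hR0 hr (by linarith)
  have e4 : (r ^ (-(n + δ))) ^ (1 - β) * (v * f ^ 2) ^ β ≤ r ^ (-(n + δ)) + v * f ^ 2 := by
    have h1 : 0 ≤ r ^ (-(n + δ)) := by positivity
    have h2 : 0 ≤ v * f ^ 2 := by positivity
    have := Real.geom_mean_le_arith_mean2_weighted (by linarith : 0 ≤ 1 - β) hβ h1 h2 (by ring)
    nlinarith [mul_nonneg hβ h1, mul_nonneg (by linarith : 0 ≤ 1 - β) h2]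
  calc Kr * f ^ q ≤ Λ * (r ^ α * v ^ β) * f ^ q :=
        mul_le_mul_of_nonneg_right hK (by positivity)
    _ = Λ * (r ^ α * (v * f ^ 2) ^ β) * f ^ (q - 2 * β) := by
        rw [e1, Real.mul_rpow hv (by positivity)]; ring
    _ ≤ Λ * (r ^ α * (v * f ^ 2) ^ β) * (C ^ (q - 2 * β) * r ^ (-ν * (q - 2 * β))) :=
        mul_le_mul_of_nonneg_left e2 (by positivity)
    _ = Λ * C ^ (q - 2 * β) * (r ^ (α + -ν * (q - 2 * β))) * (v * f ^ 2) ^ β := by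
        rw [Real.rpow_add hr0]; ring
    _ ≤ Λ * C ^ (q - 2 * β) * (R ^ (-δ) * (r ^ (-(n + δ))) ^ (1 - β)) * (v * f ^ 2) ^ β := by
        gcongr
    _ = Λ * C ^ (q - 2 * β) * R ^ (-δ) * ((r ^ (-(n + δ))) ^ (1 - β) * (v * f ^ 2) ^ β) := by ring
    _ ≤ _ := mul_le_mul_of_nonneg_left e4 (by positivity)

lemma aux_H2 {N : ℕ} (V : ℝ → ℝ≥0∞) (u w : E N → ℝ) (h : H2norm V u w = 1) :
    eLpNorm w 2 volume ≤ 1 ∧ (∫⁻ x : E N, V ‖x‖ * ENNReal.ofReal ((u x) ^ 2)) ≤ 1 := by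
  unfold H2norm at h
  rw [← Real.sqrt_eq_rpow, Real.sqrt_eq_one, ENNReal.toReal_eq_one_iff] at h
  have h1 : ∫⁻ x : E N, ENNReal.ofReal ((w x) ^ 2) ≤ 1 := by rw [← h]; exact le_self_add
  refine ⟨?_, by rw [← h]; exact le_add_self⟩
  rw [eLpNorm_eq_lintegral_rpow_enorm_toReal (by norm_num) (by norm_num)]
  refine ENNReal.rpow_le_one ?_ (by norm_num)
  refine le_trans (le_of_eq ?_) h1
  congr 1
  ext x
  rw [← ofReal_norm, ENNReal.ofReal_rpow_of_nonneg (norm_nonneg _) (by norm_num)]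
  simp

/-- Theorem 2.3: if `K(r)/(r^{α_∞}V(r)^{β_∞})` is essentially bounded at
infinity with `0 ≤ β_∞ ≤ 1`, `α_∞ ∈ ℝ`, then `R_∞(q₂,R) → 0` as `R → +∞` for all
`q₂ > max{1, 2β_∞, q*(α_∞,β_∞)}`. -/
theorem stmt5 (N : ℕ) (hN : 5 ≤ N) (V : ℝ → ℝ≥0∞) (K : ℝ → ℝ) (s : ℝ)
    (hV : HypV V) (hK : HypK K s) (R2 : ℝ) (hR2 : 0 < R2)
    (β' α' : ℝ) (hβ' : 0 ≤ β') (hβ'' : β' ≤ 1)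
    (hVfin : ∀ᵐ r ∂(volume.restrict (Set.Ioi R2)), V r < ⊤)
    (hess : essSup
      (fun r : ℝ => ENNReal.ofReal (K r) / (ENNReal.ofReal r ^ α' * V r ^ β'))
      (volume.restrict (Set.Ioi R2)) < ⊤) :
    ∀ q2 : ℝ, max (max 1 (2*β')) (qStar N α' β') < q2 →
      Tendsto (fun R => Rinf N V K q2 R) atTop (𝓝 0) := by
  intro q hq
  obtain ⟨hq1, hq3⟩ := max_lt_iff.1 hq
  obtain ⟨hq1, hq2⟩ := max_lt_iff.1 hq1
  have hN' : (5:ℝ) ≤ N := by exact_mod_cast hN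
  obtain ⟨C, hC, hpt⟩ := aux_pointwise N hN
  set ν : ℝ := (N - 4) / 2 with hν
  set δ : ℝ := (ν * q - (α' - 4 * β' + N)) / 2 with hδd
  have hδ : 0 < δ := by
    rw [qStar, div_lt_iff₀ (by linarith)] at hq3
    rw [hδd, hν]
    linarith
  set Λ : ℝ := (essSup
      (fun r : ℝ => ENNReal.ofReal (K r) / (ENNReal.ofReal r ^ α' * V r ^ β'))
      (volume.restrict (Set.Ioi R2))).toReal with hΛd
  have hΛ : 0 ≤ Λ := ENNReal.toReal_nonneg
  -- the pointwise bound of `K`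
  have hKae : ∀ᵐ r ∂(volume.restrict (Ioi (0:ℝ))), R2 < r →
      V r < ⊤ ∧ K r ≤ Λ * (r ^ α' * (V r).toReal ^ β') := by
    refine ae_restrict_of_ae ?_
    have h1 := (ae_restrict_iff' measurableSet_Ioi).1 hVfin
    have h2 := (ae_restrict_iff' measurableSet_Ioi).1 (ENNReal.ae_le_essSup
      (μ := volume.restrict (Set.Ioi R2))
      (fun r : ℝ => ENNReal.ofReal (K r) / (ENNReal.ofReal r ^ α' * V r ^ β')))
    filter_upwards [h1, h2] with r h1 h2 hr
    have hr0 : 0 < r := hR2.trans hr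
    have hVr := h1 hr
    refine ⟨hVr, ?_⟩
    have h3 := h2 hr
    rw [← ENNReal.ofReal_toReal hess.ne, ← hΛd] at h3
    have e : ENNReal.ofReal r ^ α' * V r ^ β' = ENNReal.ofReal (r ^ α' * (V r).toReal ^ β') := by
      rw [ENNReal.ofReal_mul (by positivity), ENNReal.ofReal_rpow_of_pos hr0,
        ← ENNReal.ofReal_rpow_of_nonneg ENNReal.toReal_nonneg hβ', ENNReal.ofReal_toReal hVr.ne]
    rw [e] at h3
    have hKr := hK.1 r hr0
    have hX : 0 < r ^ α' * (V r).toReal ^ β' := by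
      by_contra hneg
      rw [ENNReal.ofReal_of_nonpos (not_lt.1 hneg), ENNReal.div_zero (by simpa using hKr)] at h3
      exact absurd h3 (by simp)
    rw [ENNReal.div_le_iff (by simpa using hX) ENNReal.ofReal_ne_top,
      ← ENNReal.ofReal_mul hΛ, ENNReal.ofReal_le_ofReal_iff (by positivity)] at h3
    exact h3
  have hKx := aux_null N hN _ hKae
  set T : ℝ := (2:ℝ) ^ (N + δ) with hT
  set M0 : ℝ≥0∞ := ∫⁻ x : E N, ENNReal.ofReal (T * (1 + ‖x‖) ^ (-(N + δ))) with hM0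
  have hM0t : M0 ≠ ⊤ := by
    have hi : Integrable (fun x : E N => T * (1 + ‖x‖) ^ (-(N + δ))) :=
      (integrable_one_add_norm (by simp; linarith)).const_mul T
    exact hi.lintegral_lt_top.ne
  set D : ℝ := Λ * C ^ (q - 2 * β') with hD
  have hDn : 0 ≤ D := by positivity
  have hbound : ∀ᶠ R in atTop, Rinf N V K q R ≤ ENNReal.ofReal (D * R ^ (-δ)) * (M0 + (1 + 1)) := by
    filter_upwards [eventually_ge_atTop (max 1 (R2 + 1))] with R hR
    have hR1 : 1 ≤ R := (le_max_left _ _).trans hR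
    have hRR : R2 + 1 ≤ R := (le_max_right _ _).trans hR
    refine iSup_le ?_
    rintro ⟨⟨⟨u, w⟩, ⟨h, z⟩⟩, hu, hh, hun, hhn⟩
    simp only at hu hh hun hhn ⊢
    obtain ⟨hw1, hVu⟩ := aux_H2 V u w hun
    obtain ⟨hz1, hVh⟩ := aux_H2 V h z hhn
    have pu := hpt u w hu.1.1 hw1 hu.2
    have ph := hpt h z hh.1.1 hz1 hh.2
    have mV : Measurable (fun x : E N => V ‖x‖) := hV.1.comp measurable_norm
    have mu : AEMeasurable (fun x : E N => V ‖x‖ * ENNReal.ofReal ((u x) ^ 2)) :=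
      mV.aemeasurable.mul (hu.1.1.1.1.aemeasurable.pow_const 2).ennreal_ofReal
    have hae : ∀ᵐ x ∂(volume.restrict (Metric.ball (0 : E N) R)ᶜ),
        ENNReal.ofReal (K ‖x‖ * |u x| ^ (q - 1) * |h x|) ≤
        ENNReal.ofReal (D * R ^ (-δ)) * (ENNReal.ofReal (T * (1 + ‖x‖) ^ (-(N + δ))) +
          (V ‖x‖ * ENNReal.ofReal ((u x) ^ 2) + V ‖x‖ * ENNReal.ofReal ((h x) ^ 2))) := by
      rw [ae_restrict_iff' measurableSet_ball.compl]
      filter_upwards [pu, ph, hKx] with x pu ph hKx hx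
      have hxR : R ≤ ‖x‖ := by simpa using hx
      have hx0 : 0 < ‖x‖ := by linarith
      obtain ⟨hVt, hKb⟩ := hKx (by linarith)
      set f := max |u x| |h x| with hf
      have hf0 : 0 ≤ f := (abs_nonneg _).trans (le_max_left _ _)
      have hKp := hK.1 _ hx0
      have hmain := aux_real N ν α' β' q δ Λ C R ‖x‖ (V ‖x‖).toReal f (K ‖x‖) hβ' hβ'' (by linarith)
        hq2 hδ (by rw [hδd, hν]; ring) hΛ hC hR1 hxR ENNReal.toReal_nonneg hf0 (max_le pu ph) hKb
      have s1 : K ‖x‖ * |u x| ^ (q - 1) * |h x| ≤ K ‖x‖ * f ^ q := by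
        have e : f ^ q = f ^ (q - 1) * f := by
          rw [← Real.rpow_add_one' hf0 (by linarith)]
          congr 1; ring
        rw [e, mul_assoc]
        refine mul_le_mul_of_nonneg_left ?_ hKp.le
        refine mul_le_mul (Real.rpow_le_rpow (abs_nonneg _) (le_max_left _ _) (by linarith))
          (le_max_right _ _) (abs_nonneg _) (by positivity)
      have s2 : ‖x‖ ^ (-(N + δ)) ≤ T * (1 + ‖x‖) ^ (-(N + δ)) := by
        calc ‖x‖ ^ (-(N + δ)) ≤ ((1 + ‖x‖) / 2) ^ (-(N + δ)) :=
              Real.rpow_le_rpow_of_nonpos (by positivity) (by linarith) (by linarith)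
          _ = _ := by
              rw [Real.div_rpow (by positivity) (by norm_num),
                Real.rpow_neg (by norm_num : (0:ℝ) ≤ 2), div_inv_eq_mul, mul_comm]
      have s3 : f ^ 2 ≤ (u x) ^ 2 + (h x) ^ 2 := by
        rcases max_choice |u x| |h x| with hm | hm <;> rw [hf, hm, sq_abs] <;>
          nlinarith [sq_nonneg (u x), sq_nonneg (h x)]
      have hv0 : 0 ≤ (V ‖x‖).toReal := ENNReal.toReal_nonneg
      have s4 : K ‖x‖ * |u x| ^ (q - 1) * |h x| ≤ D * R ^ (-δ) * (T * (1 + ‖x‖) ^ (-(N + δ)) +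
          ((V ‖x‖).toReal * (u x) ^ 2 + (V ‖x‖).toReal * (h x) ^ 2)) := by
        refine s1.trans (hmain.trans ?_)
        refine mul_le_mul_of_nonneg_left ?_ (by positivity)
        have := mul_le_mul_of_nonneg_left s3 hv0
        linarith
      refine (ENNReal.ofReal_le_ofReal s4).trans (le_of_eq ?_)
      rw [ENNReal.ofReal_mul (by positivity), ENNReal.ofReal_add (by positivity) (by positivity),
        ENNReal.ofReal_add (by positivity) (by positivity), ENNReal.ofReal_mul hv0,
        ENNReal.ofReal_mul hv0, ENNReal.ofReal_toReal hVt.ne]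
    refine (lintegral_mono_ae hae).trans ?_
    refine (setLIntegral_le_lintegral _ _).trans ?_
    rw [lintegral_const_mul' _ _ ENNReal.ofReal_ne_top]
    gcongr
    rw [lintegral_add_left (by fun_prop), lintegral_add_left' mu]
    gcongr
  have hlim : Tendsto (fun R : ℝ => ENNReal.ofReal (D * R ^ (-δ)) * (M0 + (1 + 1))) atTop (𝓝 0) := by
    have h1 : Tendsto (fun R : ℝ => D * R ^ (-δ)) atTop (𝓝 (D * 0)) :=
      (tendsto_rpow_neg_atTop hδ).const_mul D
    have h2 := ENNReal.Tendsto.mul_const (b := M0 + (1 + 1)) (ENNReal.tendsto_ofReal h1)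
      (Or.inr (by simp [hM0t]))
    simpa using h2
  exact tendsto_of_tendsto_of_tendsto_of_le_of_le' tendsto_const_nhds hlim
    (Eventually.of_forall fun _ => bot_le) hbound

end
end
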